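/- Let u ∈ C([0,1]: H⁴(ℝ)) ∩ C¹([0,1]: H¹(ℝ)) be a real solution of the k-gKdV equation ∂_t u + ∂_x³ u + u^k ∂_x u = 0 on ℝ × [0,1]. If supp u(·,0) ⊆ (−∞, b) and supp u(·,1) ⊆ (−∞, b) for some b < ∞, then u ≡ 0. -/

import Mathlib

open MeasureTheory

noncomputable def pdx (f : ℝ × ℝ → ℝ) : ℝ × ℝ → ℝ := fun p => deriv (fun x => f (x, p.2)) p.1
noncomputable def pdt (f : ℝ × ℝ → ℝ) : ℝ × ℝ → ℝ := fun p => deriv (fun t => f (p.1, t)) p.2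

section PartialDerivatives

variable {f g : ℝ × ℝ → ℝ}

lemma ContDiff.hasDerivAt_fst (hf : ContDiff ℝ (⊤ : ℕ∞) f) (x t : ℝ) :
    HasDerivAt (fun y => f (y, t)) (fderiv ℝ f (x, t) (1, 0)) x :=
  (hf.differentiable (by simp) (x, t)).hasFDerivAt.comp_hasDerivAt x
    ((hasDerivAt_id x).prodMk (hasDerivAt_const x t))

lemma ContDiff.hasDerivAt_snd (hf : ContDiff ℝ (⊤ : ℕ∞) f) (x t : ℝ) :
    HasDerivAt (fun s => f (x, s)) (fderiv ℝ f (x, t) (0, 1)) t :=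
  (hf.differentiable (by simp) (x, t)).hasFDerivAt.comp_hasDerivAt t
    ((hasDerivAt_const t x).prodMk (hasDerivAt_id t))

lemma pdx_eq_fderiv (hf : ContDiff ℝ (⊤ : ℕ∞) f) : pdx f = fun p => fderiv ℝ f p (1, 0) :=
  funext fun p => (hf.hasDerivAt_fst p.1 p.2).deriv

lemma pdt_eq_fderiv (hf : ContDiff ℝ (⊤ : ℕ∞) f) : pdt f = fun p => fderiv ℝ f p (0, 1) :=
  funext fun p => (hf.hasDerivAt_snd p.1 p.2).deriv

lemma ContDiff.hasDerivAt_pdx (hf : ContDiff ℝ (⊤ : ℕ∞) f) (x t : ℝ) :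
    HasDerivAt (fun y => f (y, t)) (pdx f (x, t)) x :=
  (hf.hasDerivAt_fst x t).differentiableAt.hasDerivAt

lemma ContDiff.hasDerivAt_pdt (hf : ContDiff ℝ (⊤ : ℕ∞) f) (x t : ℝ) :
    HasDerivAt (fun s => f (x, s)) (pdt f (x, t)) t :=
  (hf.hasDerivAt_snd x t).differentiableAt.hasDerivAt

lemma ContDiff.pdx (hf : ContDiff ℝ (⊤ : ℕ∞) f) : ContDiff ℝ (⊤ : ℕ∞) (pdx f) := by
  rw [pdx_eq_fderiv hf]
  exact (hf.fderiv_right (m := (⊤ : ℕ∞)) (by simp)).clm_apply contDiff_const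

lemma ContDiff.pdt (hf : ContDiff ℝ (⊤ : ℕ∞) f) : ContDiff ℝ (⊤ : ℕ∞) (pdt f) := by
  rw [pdt_eq_fderiv hf]
  exact (hf.fderiv_right (m := (⊤ : ℕ∞)) (by simp)).clm_apply contDiff_const

lemma pdt_pdx (hf : ContDiff ℝ (⊤ : ℕ∞) f) : pdt (pdx f) = pdx (pdt f) := by
  have hd : Differentiable ℝ (fderiv ℝ f) :=
    (hf.fderiv_right (m := (⊤ : ℕ∞)) (by simp)).differentiable (by simp)
  rw [pdt_eq_fderiv hf.pdx, pdx_eq_fderiv hf.pdt, pdx_eq_fderiv hf, pdt_eq_fderiv hf]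
  funext p
  have key : ∀ v w : ℝ × ℝ, fderiv ℝ (fun q => fderiv ℝ f q v) p w
      = fderiv ℝ (fderiv ℝ f) p w v := by
    intro v w
    rw [fderiv_clm_apply (hd p) (differentiableAt_const v)]
    simp
  rw [key, key]
  have h2 : ((2 : ℕ∞) : WithTop ℕ∞) ≤ ((⊤ : ℕ∞) : WithTop ℕ∞) := WithTop.coe_le_coe.2 le_top
  exact (hf.contDiffAt.isSymmSndFDerivAt (by simpa using h2)).eq _ _

lemma pdx_eq_of_hasDerivAt
    (h : ∀ x t, HasDerivAt (fun y => f (y, t)) (g (x, t)) x) : pdx f = g :=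
  funext fun p => (h p.1 p.2).deriv

lemma pdt_eq_of_hasDerivAt
    (h : ∀ x t, HasDerivAt (fun s => f (x, s)) (g (x, t)) t) : pdt f = g :=
  funext fun p => (h p.1 p.2).deriv

lemma deriv_eq_zero_of_forall_le {g : ℝ → ℝ} (hg : Differentiable ℝ g) {c : ℝ}
    (h : ∀ x ≤ c, g x = 0) : ∀ x ≤ c, deriv g x = 0 := by
  intro x hx
  have h1 := (hg x).hasDerivAt.hasDerivWithinAt (s := Set.Iic x)
  have h2 : HasDerivWithinAt g 0 (Set.Iic x) x :=
    (hasDerivWithinAt_const x _ (0 : ℝ)).congr (fun y hy => h y (le_trans hy hx)) (h x hx)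
  exact (uniqueDiffWithinAt_Iic x).eq_deriv _ h1 h2

lemma deriv_eq_zero_of_forall_ge {g : ℝ → ℝ} (hg : Differentiable ℝ g) {c : ℝ}
    (h : ∀ x, c ≤ x → g x = 0) : ∀ x, c ≤ x → deriv g x = 0 := by
  intro x hx
  have h1 := (hg x).hasDerivAt.hasDerivWithinAt (s := Set.Ici x)
  have h2 : HasDerivWithinAt g 0 (Set.Ici x) x :=
    (hasDerivWithinAt_const x _ (0 : ℝ)).congr (fun y hy => h y (le_trans hx hy)) (h x hx)
  exact (uniqueDiffWithinAt_Ici x).eq_deriv _ h1 h2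

lemma pdx_eq_zero_of_forall_le (hf : ContDiff ℝ (⊤ : ℕ∞) f) {c t : ℝ}
    (h : ∀ x ≤ c, f (x, t) = 0) : ∀ x ≤ c, pdx f (x, t) = 0 :=
  deriv_eq_zero_of_forall_le (fun x => (hf.hasDerivAt_pdx x t).differentiableAt) h

lemma pdx_eq_zero_of_forall_ge (hf : ContDiff ℝ (⊤ : ℕ∞) f) {c t : ℝ}
    (h : ∀ x, c ≤ x → f (x, t) = 0) : ∀ x, c ≤ x → pdx f (x, t) = 0 :=
  deriv_eq_zero_of_forall_ge (fun x => (hf.hasDerivAt_pdx x t).differentiableAt) h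

end PartialDerivatives

section Rectangles

variable {F : ℝ × ℝ → ℝ} {a b c d : ℝ}

lemma Continuous.integrableOn_rectangle (hF : Continuous F) :
    IntegrableOn F (Set.Icc a b ×ˢ Set.Icc c d) :=
  hF.continuousOn.integrableOn_compact (isCompact_Icc.prod isCompact_Icc)

lemma setIntegral_rectangle_eq_zero_of_fst (hab : a ≤ b) (hF : Continuous F)
    (h : ∀ t ∈ Set.Icc c d, ∫ x in a..b, F (x, t) = 0) :
    ∫ p in Set.Icc a b ×ˢ Set.Icc c d, F p = 0 := by
  have hi : Integrable F ((volume.restrict (Set.Icc a b)).prod (volume.restrict (Set.Icc c d))) := by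
    rw [Measure.prod_restrict]; exact hF.integrableOn_rectangle
  rw [Measure.volume_eq_prod, ← Measure.prod_restrict, integral_prod_symm _ hi]
  refine setIntegral_eq_zero_of_forall_eq_zero fun t ht => ?_
  rw [integral_Icc_eq_integral_Ioc, ← intervalIntegral.integral_of_le hab]
  exact h t ht

lemma setIntegral_rectangle_eq_zero_of_snd (hcd : c ≤ d) (hF : Continuous F)
    (h : ∀ x ∈ Set.Icc a b, ∫ t in c..d, F (x, t) = 0) :
    ∫ p in Set.Icc a b ×ˢ Set.Icc c d, F p = 0 := by
  have hi : Integrable F ((volume.restrict (Set.Icc a b)).prod (volume.restrict (Set.Icc c d))) := by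
    rw [Measure.prod_restrict]; exact hF.integrableOn_rectangle
  rw [Measure.volume_eq_prod, ← Measure.prod_restrict, integral_prod _ hi]
  refine setIntegral_eq_zero_of_forall_eq_zero fun t ht => ?_
  rw [integral_Icc_eq_integral_Ioc, ← intervalIntegral.integral_of_le hcd]
  exact h t ht

end Rectangles

section Carleman

variable {f : ℝ × ℝ → ℝ}

lemma hasDerivAt_exp_const_sub (c x : ℝ) :
    HasDerivAt (fun y => Real.exp (c - y)) (-Real.exp (c - x)) x := by
  simpa using ((hasDerivAt_id x).const_sub c).exp

/-- Conjugation of `∂ₜ + ∂ₓ³` by the weight `exp ψ`, where `∂ₓ ψ = lam * (2 - exp (c - x))`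
and `∂ₜ ψ = -kap * (t - t0)`. -/
noncomputable def conjAiry (c lam kap t0 : ℝ) (f : ℝ × ℝ → ℝ) (p : ℝ × ℝ) : ℝ :=
  pdt f p + kap * (p.2 - t0) * f p + pdx (pdx (pdx f)) p
    - 3 * (lam * (2 - Real.exp (c - p.1))) * pdx (pdx f) p
    + (3 * (lam * (2 - Real.exp (c - p.1))) ^ 2 - 3 * (lam * Real.exp (c - p.1))) * pdx f p
    + (3 * (lam * (2 - Real.exp (c - p.1))) * (lam * Real.exp (c - p.1))
      + lam * Real.exp (c - p.1) - (lam * (2 - Real.exp (c - p.1))) ^ 3) * f p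

lemma continuous_conjAiry (hf : ContDiff ℝ (⊤ : ℕ∞) f) (c lam kap t0 : ℝ) :
    Continuous (conjAiry c lam kap t0 f) := by
  have h0 := hf.continuous
  have h1 := hf.pdx.continuous
  have h2 := hf.pdx.pdx.continuous
  have h3 := hf.pdx.pdx.pdx.continuous
  have ht := hf.pdt.continuous
  unfold conjAiry
  fun_prop

lemma carleman_flux_fst (hf : ContDiff ℝ (⊤ : ℕ∞) f) {c X lam : ℝ} (g : ℝ) {t : ℝ}
    (hl : ∀ x ≤ c, f (x, t) = 0) (hr : ∀ x, X ≤ x → f (x, t) = 0) (D : ℝ → ℝ)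
    (hDc : Continuous D)
    (hD : ∀ x, D x =
      let E := Real.exp (c - x)
      let m := lam * (2 - E)
      let f0 := f (x, t); let f1 := pdx f (x, t); let f2 := pdx (pdx f) (x, t)
      let f3 := pdx (pdx (pdx f)) (x, t); let ft := pdt f (x, t); let f1t := pdt (pdx f) (x, t)
      let g0 := g - m ^ 3 + lam * E
      2 * (-3 * m * f2 - 3 * lam * E * f1 + g0 * f0)
        * (ft + f3 + 3 * m ^ 2 * f1 + 3 * m * (lam * E) * f0)
      - (6 * m * f1 * f1t + 2 * g0 * f0 * ft)
      - (9 * lam * E * f2 ^ 2 + (18 * m ^ 2 * lam * E - 6 * lam * E) * f1 ^ 2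
        + (9 * m ^ 4 * lam * E - 3 * lam ^ 3 * E ^ 3 + 18 * m * lam ^ 2 * E ^ 2
          - 3 * m ^ 2 * lam * E + lam * E) * f0 ^ 2)) :
    ∫ x in c..X, D x = 0 := by
  have hE := fun x => hasDerivAt_exp_const_sub c x
  have hm : ∀ x, HasDerivAt (fun y => lam * (2 - Real.exp (c - y))) (lam * Real.exp (c - x)) x := by
    intro x
    simpa using ((hE x).const_sub 2).const_mul lam
  have h0 := fun x => hf.hasDerivAt_pdx x t
  have h1 := fun x => hf.pdx.hasDerivAt_pdx x t
  have h2 := fun x => hf.pdx.pdx.hasDerivAt_pdx x t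
  have ht := fun x => hf.pdt.hasDerivAt_pdx x t
  rw [← pdt_pdx hf] at ht
  have hlE := fun x => (hE x).const_mul lam
  have hg0 := fun x => (((hm x).pow 3).const_sub g).add (hlE x)
  have hg1 := fun x => (((hm x).pow 2).mul (hlE x)).const_mul (-3)
  have hg1 := fun x => (hg1 x).sub (hlE x)
  have hg2a := fun x => ((hm x).mul ((hlE x).pow 2)).const_mul (-6)
  have hg2b := fun x => (((hm x).pow 2).mul (hlE x)).const_mul 3
  have hg2 := fun x => ((hg2a x).add (hg2b x)).add (hlE x)
  have d1 := fun x => (((hm x).mul (h1 x)).mul (ht x)).const_mul (-6)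
  have d2 := fun x => ((hm x).mul ((h2 x).pow 2)).const_mul (-3)
  have d3 := fun x => (((hlE x).mul (h1 x)).mul (h2 x)).const_mul (-6)
  have d4 := fun x => ((hlE x).mul ((h1 x).pow 2)).const_mul (-3)
  have d5 := fun x => (((hm x).pow 3).mul ((h1 x).pow 2)).const_mul (-9)
  have d6 := fun x => (((((hm x).pow 2).mul (hlE x)).mul (h1 x)).mul (h0 x)).const_mul (-18)
  have d7 := fun x => ((((hlE x).pow 2).sub ((hm x).mul (hlE x))).mul
    ((hm x).mul ((h0 x).pow 2))).const_mul 9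
  have d8 := fun x => ((((hg0 x).mul (h0 x))).mul (h2 x)).const_mul 2
  have d9 := fun x => ((((hg1 x).mul (h0 x))).mul (h1 x)).const_mul (-2)
  have d10 := fun x => (((hg0 x).mul ((h1 x).pow 2))).const_mul (-1)
  have d11 := fun x => (hg2 x).mul ((h0 x).pow 2)
  have d12 := fun x => ((hg0 x).mul (((hm x).pow 2).mul ((h0 x).pow 2))).const_mul 3
  have key := fun x => ((((d1 x).add (d2 x)).add ((d3 x).add (d4 x))).add
    (((d5 x).add (d6 x)).add ((d7 x).add (d8 x)))).add
    (((d9 x).add (d10 x)).add ((d11 x).add (d12 x)))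
  have z0l := hl c le_rfl
  have z1l := pdx_eq_zero_of_forall_le hf hl
  have z2l := pdx_eq_zero_of_forall_le hf.pdx z1l c le_rfl
  have z0r := hr X le_rfl
  have z1r := pdx_eq_zero_of_forall_ge hf hr
  have z2r := pdx_eq_zero_of_forall_ge hf.pdx z1r X le_rfl
  replace z1l := z1l c le_rfl
  replace z1r := z1r X le_rfl
  rw [intervalIntegral.integral_eq_sub_of_hasDerivAt (fun x _ => (key x).congr_deriv ?_)
    (hDc.intervalIntegrable _ _)]
  · simp [z0l, z1l, z2l, z0r, z1r, z2r]
  · rw [hD x]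
    simp only [Pi.mul_apply, Pi.add_apply, Pi.sub_apply, Pi.pow_apply, Nat.cast_ofNat]
    ring

lemma carleman_flux_snd (hf : ContDiff ℝ (⊤ : ℕ∞) f) (m g0 kap t0 x : ℝ)
    (h0 : ∀ y, f (y, 0) = 0) (h1 : ∀ y, f (y, 1) = 0) :
    ∫ t in (0:ℝ)..1, (6 * m * pdx f (x, t) * pdt (pdx f) (x, t)
      + 2 * (kap * (t - t0) + g0) * f (x, t) * pdt f (x, t) + kap * f (x, t) ^ 2) = 0 := by
  have e0 := fun t => hf.hasDerivAt_pdt x t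
  have e1 := fun t => hf.pdx.hasDerivAt_pdt x t
  have eg : ∀ t, HasDerivAt (fun t => kap * (t - t0) + g0) kap t := fun t => by
    simpa using (((hasDerivAt_id t).sub_const t0).const_mul kap).add_const g0
  have key := fun t => (((e1 t).pow 2).const_mul (3 * m)).add ((eg t).mul ((e0 t).pow 2))
  have c0 := hf.continuous
  have c1 := hf.pdx.continuous
  have c2 := hf.pdt.continuous
  have c3 := hf.pdx.pdt.continuous
  rw [intervalIntegral.integral_eq_sub_of_hasDerivAt (fun t _ => (key t).congr_deriv ?_)
    (Continuous.intervalIntegrable (by fun_prop) _ _)]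
  · have z0 := pdx_eq_zero_of_forall_le hf (c := x) (t := 0) (fun y _ => h0 y) x le_rfl
    have z1 := pdx_eq_zero_of_forall_le hf (c := x) (t := 1) (fun y _ => h1 y) x le_rfl
    simp [z0, z1, h0, h1]
  · simp only [Pi.pow_apply, Nat.cast_ofNat]
    ring

theorem carleman_inequality (hf : ContDiff ℝ (⊤ : ℕ∞) f) {c X lam : ℝ} (kap t0 : ℝ)
    (hcX : c ≤ X) (hlam : 1 ≤ lam)
    (hl : ∀ t ∈ Set.Icc (0:ℝ) 1, ∀ x ≤ c, f (x, t) = 0)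
    (hr : ∀ t ∈ Set.Icc (0:ℝ) 1, ∀ x, X ≤ x → f (x, t) = 0)
    (h0 : ∀ x, f (x, 0) = 0) (h1 : ∀ x, f (x, 1) = 0) :
    0 ≤ ∫ p in Set.Icc c X ×ˢ Set.Icc (0:ℝ) 1, (conjAiry c lam kap t0 f p ^ 2
      - (Real.exp (c - p.1) * (12 * lam ^ 3 * pdx f p ^ 2 + 3 * lam ^ 5 * f p ^ 2)
        - kap * f p ^ 2)) := by
  have c0 := hf.continuous
  have c1 := hf.pdx.continuous
  have c2 := hf.pdx.pdx.continuous
  have c3 := hf.pdx.pdx.pdx.continuous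
  have ct := hf.pdt.continuous
  have c1t := hf.pdx.pdt.continuous
  have cL := continuous_conjAiry hf c lam kap t0
  set DT : ℝ × ℝ → ℝ := fun p =>
    6 * (lam * (2 - Real.exp (c - p.1))) * pdx f p * pdt (pdx f) p
      + 2 * (kap * (p.2 - t0) + (-(lam * (2 - Real.exp (c - p.1))) ^ 3
        + lam * Real.exp (c - p.1))) * f p * pdt f p + kap * f p ^ 2 with hDT
  set DX : ℝ × ℝ → ℝ := fun p =>
      let E := Real.exp (c - p.1)
      let m := lam * (2 - E)
      let f0 := f p; let f1 := pdx f p; let f2 := pdx (pdx f) p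
      let f3 := pdx (pdx (pdx f)) p; let ft := pdt f p; let f1t := pdt (pdx f) p
      let g0 := kap * (p.2 - t0) - m ^ 3 + lam * E
      2 * (-3 * m * f2 - 3 * lam * E * f1 + g0 * f0)
        * (ft + f3 + 3 * m ^ 2 * f1 + 3 * m * (lam * E) * f0)
      - (6 * m * f1 * f1t + 2 * g0 * f0 * ft)
      - (9 * lam * E * f2 ^ 2 + (18 * m ^ 2 * lam * E - 6 * lam * E) * f1 ^ 2
        + (9 * m ^ 4 * lam * E - 3 * lam ^ 3 * E ^ 3 + 18 * m * lam ^ 2 * E ^ 2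
          - 3 * m ^ 2 * lam * E + lam * E) * f0 ^ 2) with hDX
  have cDT : Continuous DT := by fun_prop
  have cDX : Continuous DX := by fun_prop
  have iT : ∫ p in Set.Icc c X ×ˢ Set.Icc (0:ℝ) 1, DT p = 0 :=
    setIntegral_rectangle_eq_zero_of_snd zero_le_one cDT fun x _ =>
      carleman_flux_snd hf (lam * (2 - Real.exp (c - x)))
        (-(lam * (2 - Real.exp (c - x))) ^ 3 + lam * Real.exp (c - x)) kap t0 x h0 h1
  have iX : ∫ p in Set.Icc c X ×ˢ Set.Icc (0:ℝ) 1, DX p = 0 :=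
    setIntegral_rectangle_eq_zero_of_fst hcX cDX fun t ht =>
      carleman_flux_fst hf (kap * (t - t0)) (hl t ht) (hr t ht) _ (by fun_prop) fun x => rfl
  have hsum : ∫ p in Set.Icc c X ×ˢ Set.Icc (0:ℝ) 1, (DX p + DT p) = 0 := by
    rw [integral_add cDX.integrableOn_rectangle cDT.integrableOn_rectangle, iT, iX, add_zero]
  refine hsum.ge.trans (setIntegral_mono_on (Continuous.integrableOn_rectangle ?_)
    (Continuous.integrableOn_rectangle ?_) (measurableSet_Icc.prod measurableSet_Icc) ?_)
  · fun_prop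
  · fun_prop
  rintro ⟨x, t⟩ ⟨hx, ht⟩
  have hE0 : 0 < Real.exp (c - x) := Real.exp_pos _
  have hE1 : Real.exp (c - x) ≤ 1 := Real.exp_le_one_iff.2 (by linarith [hx.1])
  simp only [hDX, hDT, conjAiry]
  generalize Real.exp (c - x) = E at *
  generalize f (x, t) = u0
  generalize pdx (pdx (pdx f)) (x, t) = u3
  generalize pdx (pdx f) (x, t) = u2
  generalize pdt (pdx f) (x, t) = u1t
  generalize pdx f (x, t) = u1
  generalize pdt f (x, t) = ut
  have hm : lam ≤ lam * (2 - E) := by nlinarith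
  generalize lam * (2 - E) = m at *
  have hm1 : 1 ≤ m := hlam.trans hm
  have q1 : 12 * lam ^ 3 * E ≤ 18 * m ^ 2 * lam * E - 6 * lam * E := by
    have : 0 ≤ lam * E := by positivity
    have h2 : lam ^ 2 ≤ m ^ 2 := by gcongr
    have h3 : 1 ≤ lam ^ 2 := one_le_pow₀ hlam
    nlinarith
  have q0 : 3 * lam ^ 5 * E ≤ 9 * m ^ 4 * lam * E - 3 * lam ^ 3 * E ^ 3 + 18 * m * lam ^ 2 * E ^ 2
          - 3 * m ^ 2 * lam * E + lam * E := by
    have hlE : 0 ≤ lam * E := by positivity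
    have h4 : lam ^ 4 ≤ m ^ 4 := by gcongr
    have h2 : lam ^ 2 ≤ m ^ 2 := by gcongr
    have h3 : m ^ 2 ≤ m ^ 4 := pow_le_pow_right₀ hm1 (by norm_num)
    have h5 : lam ^ 2 * E ^ 2 ≤ m ^ 4 := by
      calc lam ^ 2 * E ^ 2 ≤ lam ^ 2 * 1 := by gcongr; exact pow_le_one₀ hE0.le hE1
        _ ≤ m ^ 4 := by linarith
    have h6 : 0 ≤ 18 * m * lam ^ 2 * E ^ 2 := by positivity
    have h7 : lam * E * (3 * lam ^ 4) ≤ lam * E * (9 * m ^ 4 - 3 * (lam ^ 2 * E ^ 2) - 3 * m ^ 2) :=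
      mul_le_mul_of_nonneg_left (by linarith) hlE
    nlinarith
  have p1 := mul_le_mul_of_nonneg_right q1 (sq_nonneg u1)
  have p0 := mul_le_mul_of_nonneg_right q0 (sq_nonneg u0)
  have p2 : 0 ≤ 9 * lam * E * u2 ^ 2 := by positivity
  have s1 := sq_nonneg (-3 * m * u2 - 3 * lam * E * u1
    + (kap * (t - t0) - m ^ 3 + lam * E) * u0)
  have s2 := sq_nonneg (ut + u3 + 3 * m ^ 2 * u1 + 3 * m * (lam * E) * u0)
  linear_combination p1 + p0 + p2 + s1 + s2

end Carleman

section SobolevBounds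

lemma integral_sq_le_of_eLpNorm_le {g : ℝ → ℝ} (hg : Continuous g) {A : ℝ} (hA : 0 ≤ A)
    (h : eLpNorm g 2 volume ≤ ENNReal.ofReal A) {p q : ℝ} (hpq : p ≤ q) :
    ∫ x in p..q, g x ^ 2 ≤ A ^ 2 := by
  have hm : MemLp g 2 volume := ⟨hg.aestronglyMeasurable, h.trans_lt ENNReal.ofReal_lt_top⟩
  rw [hm.eLpNorm_eq_integral_rpow_norm (by simp) (by simp), ENNReal.ofReal_le_ofReal_iff hA] at h
  have h2 : ∫ x, g x ^ 2 ≤ A ^ 2 := by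
    have h0 : 0 ≤ ∫ x, g x ^ 2 := integral_nonneg fun x => sq_nonneg _
    have e : (∫ a, ‖g a‖ ^ (2 : ENNReal).toReal) = ∫ x, g x ^ 2 := by
      simp
    rw [e] at h
    have := pow_le_pow_left₀ (by positivity) h 2
    rwa [← Real.rpow_natCast, ← Real.rpow_mul h0, ENNReal.toReal_ofNat, Nat.cast_ofNat,
      inv_mul_cancel₀ two_ne_zero, Real.rpow_one] at this
  rw [intervalIntegral.integral_of_le hpq]
  exact (setIntegral_le_integral hm.integrable_sq (ae_of_all _ fun x => sq_nonneg _)).trans h2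

lemma sq_le_integral_of_hasDerivAt {g g' : ℝ → ℝ} (hg : ∀ x, HasDerivAt g (g' x) x)
    (hg' : Continuous g') (x : ℝ) :
    g x ^ 2 = ∫ y in x..x + 1, (g y ^ 2 + 2 * (y - (x + 1)) * (g y * g' y)) := by
  have hc : Continuous g := continuous_iff_continuousAt.2 fun y => (hg y).continuousAt
  rw [intervalIntegral.integral_eq_sub_of_hasDerivAt
    (fun y _ => (((hasDerivAt_id y).sub_const (x + 1)).mul ((hg y).pow 2)).congr_deriv ?_)
    (Continuous.intervalIntegrable (by fun_prop) _ _)]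
  · simp
  · simp only [id, Pi.pow_apply, Nat.cast_ofNat]
    ring

lemma sq_le_of_integral_sq_le {g g' : ℝ → ℝ} (hg : ∀ x, HasDerivAt g (g' x) x)
    (hg' : Continuous g') {M : ℝ} {x : ℝ} (h0 : ∫ y in x..x + 1, g y ^ 2 ≤ M)
    (h1 : ∫ y in x..x + 1, g' y ^ 2 ≤ M) : g x ^ 2 ≤ 3 * M := by
  have hc : Continuous g := continuous_iff_continuousAt.2 fun y => (hg y).continuousAt
  have hi := fun (f : ℝ → ℝ) (hf : Continuous f) => hf.intervalIntegrable (μ := volume) x (x + 1)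
  calc g x ^ 2 = _ := sq_le_integral_of_hasDerivAt hg hg' x
    _ ≤ ∫ y in x..x + 1, (2 * g y ^ 2 + g' y ^ 2) := by
      refine intervalIntegral.integral_mono_on (by linarith) (hi _ (by fun_prop))
        (hi _ (by fun_prop)) fun y hy => ?_
      have h1 : (y - (x + 1)) ^ 2 ≤ 1 := by nlinarith [hy.1, hy.2]
      nlinarith [sq_nonneg ((y - (x + 1)) * g y - g' y), mul_le_mul_of_nonneg_right h1
        (sq_nonneg (g y))]
    _ = 2 * (∫ y in x..x + 1, g y ^ 2) + ∫ y in x..x + 1, g' y ^ 2 := by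
      rw [intervalIntegral.integral_add (hi _ (by fun_prop)) (hi _ (by fun_prop)),
        intervalIntegral.integral_const_mul]
    _ ≤ 3 * M := by linarith

lemma sq_le_of_abs_deriv_le {g g' : ℝ → ℝ} (hg : ∀ x, HasDerivAt g (g' x) x)
    (hg' : Continuous g') {B d x : ℝ} (hd : 0 < d) (hB : ∀ y, |g' y| ≤ B) :
    g x ^ 2 ≤ (1 + 1 / d) * (∫ y in x..x + 1, g y ^ 2) + d * B ^ 2 := by
  have hc : Continuous g := continuous_iff_continuousAt.2 fun y => (hg y).continuousAt
  have hi := fun (f : ℝ → ℝ) (hf : Continuous f) => hf.intervalIntegrable (μ := volume) x (x + 1)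
  calc g x ^ 2 = _ := sq_le_integral_of_hasDerivAt hg hg' x
    _ ≤ ∫ y in x..x + 1, ((1 + 1 / d) * g y ^ 2 + d * B ^ 2) := by
      refine intervalIntegral.integral_mono_on (by linarith) (hi _ (by fun_prop))
        (hi _ (by fun_prop)) fun y hy => ?_
      have h1 : (y - (x + 1)) ^ 2 ≤ 1 := by nlinarith [hy.1, hy.2]
      have h2 : g' y ^ 2 ≤ B ^ 2 := sq_le_sq.2 ((hB y).trans (le_abs_self B))
      have h3 : 2 * (y - (x + 1)) * (g y * g' y)
          ≤ 1 / d * g y ^ 2 + d * ((y - (x + 1)) ^ 2 * g' y ^ 2) := by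
        have e : 1 / d * g y ^ 2 + d * ((y - (x + 1)) ^ 2 * g' y ^ 2)
            - 2 * (y - (x + 1)) * (g y * g' y)
            = 1 / d * (g y - d * (y - (x + 1)) * g' y) ^ 2 := by field_simp; ring
        have : 0 ≤ 1 / d * (g y - d * (y - (x + 1)) * g' y) ^ 2 := by positivity
        linarith
      have h4 : (y - (x + 1)) ^ 2 * g' y ^ 2 ≤ B ^ 2 :=
        (mul_le_mul h1 h2 (sq_nonneg _) zero_le_one).trans (one_mul _).le
      nlinarith
    _ = (1 + 1 / d) * (∫ y in x..x + 1, g y ^ 2) + d * B ^ 2 := by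
      rw [intervalIntegral.integral_add (hi _ (by fun_prop)) (hi _ (by fun_prop)),
        intervalIntegral.integral_const_mul, intervalIntegral.integral_const]
      simp

/-- A Landau-type interpolation inequality. -/
lemma abs_deriv_le_of_abs_le {g g' g'' : ℝ → ℝ} (hg : ∀ x, HasDerivAt g (g' x) x)
    (hg' : ∀ x, HasDerivAt g' (g'' x) x) {A B s x : ℝ} (hs : 0 < s)
    (hA : ∀ y, x ≤ y → |g y| ≤ A) (hB : ∀ y, |g'' y| ≤ B) : |g' x| ≤ 2 * A / s + B * s := by
  obtain ⟨y, hy, hy'⟩ := exists_hasDerivAt_eq_slope g g' (a := x) (b := x + s) (by linarith)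
    (fun z _ => (hg z).continuousAt.continuousWithinAt) (fun z _ => hg z)
  have h1 : |g' y| ≤ 2 * A / s := by
    rw [hy', add_sub_cancel_left, abs_div, abs_of_pos hs]
    gcongr
    have h := abs_sub (g (x + s)) (g x)
    have h2 := hA (x + s) (by linarith)
    have h3 := hA x le_rfl
    linarith
  have h2 : |g' x - g' y| ≤ B * s := by
    have hB0 : 0 ≤ B := (abs_nonneg _).trans (hB 0)
    have := Convex.norm_image_sub_le_of_norm_hasDerivWithin_le (f := g') (f' := g'') (C := B)
      (s := Set.univ) (x := y) (y := x) (fun z _ => (hg' z).hasDerivWithinAt)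
      (fun z _ => hB z) convex_univ trivial trivial
    rw [Real.norm_eq_abs, Real.norm_eq_abs] at this
    refine this.trans (mul_le_mul_of_nonneg_left ?_ hB0)
    rw [abs_sub_comm, abs_of_pos (by linarith [hy.1])]
    linarith [hy.2]
  calc |g' x| = |g' y + (g' x - g' y)| := by ring_nf
    _ ≤ |g' y| + |g' x - g' y| := abs_add_le _ _
    _ ≤ _ := add_le_add h1 h2

lemma iteratedDeriv_eq_iterate_pdx (u : ℝ × ℝ → ℝ) (t : ℝ) (n : ℕ) :
    iteratedDeriv n (fun y => u (y, t)) = fun x => (pdx^[n] u) (x, t) := by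
  induction n with
  | zero => simp
  | succ n ih => rw [iteratedDeriv_succ, ih, Function.iterate_succ_apply']; rfl

lemma ContDiff.iterate_pdx {u : ℝ × ℝ → ℝ} (hu : ContDiff ℝ (⊤ : ℕ∞) u) (n : ℕ) :
    ContDiff ℝ (⊤ : ℕ∞) (_root_.pdx^[n] u) := by
  induction n with
  | zero => exact hu
  | succ n ih => rw [Function.iterate_succ_apply']; exact ih.pdx

lemma exists_L2_and_sup_bounds {u : ℝ × ℝ → ℝ} (hu : ContDiff ℝ (⊤ : ℕ∞) u)
    (hH4 : ∃ A : ℝ, ∀ t ∈ Set.Icc (0:ℝ) 1, ∀ n ≤ 4,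
      eLpNorm (fun x => iteratedDeriv n (fun y => u (y, t)) x) 2 volume ≤ ENNReal.ofReal A) :
    ∃ M, ∀ t ∈ Set.Icc (0:ℝ) 1,
      (∀ n ≤ 1, ∀ p q, p ≤ q → ∫ x in p..q, (pdx^[n] u) (x, t) ^ 2 ≤ M) ∧
      (∀ n ≤ 3, ∀ x, |(pdx^[n] u) (x, t)| ≤ M) := by
  obtain ⟨A, hA⟩ := hH4
  have hL : ∀ t ∈ Set.Icc (0:ℝ) 1, ∀ n ≤ 4, ∀ p q, p ≤ q →
      ∫ x in p..q, (pdx^[n] u) (x, t) ^ 2 ≤ |A| ^ 2 := by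
    intro t ht n hn p q hpq
    have hc := (hu.iterate_pdx n).continuous
    refine integral_sq_le_of_eLpNorm_le (by fun_prop) (abs_nonneg A) ?_ hpq
    have := hA t ht n hn
    rw [iteratedDeriv_eq_iterate_pdx] at this
    exact this.trans (ENNReal.ofReal_le_ofReal (le_abs_self A))
  refine ⟨3 * |A| ^ 2 + 1, fun t ht => ⟨fun n hn p q hpq => ?_, fun n hn x => ?_⟩⟩
  · nlinarith [hL t ht n (by omega) p q hpq, sq_nonneg |A|]
  · have hc := (hu.iterate_pdx n).pdx.continuous
    have h1 := hL t ht (n + 1) (by omega) x (x + 1) (by linarith)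
    rw [Function.iterate_succ_apply'] at h1
    have := sq_le_of_integral_sq_le (fun y => (hu.iterate_pdx n).hasDerivAt_pdx y t)
      (by fun_prop) (hL t ht n (by omega) x (x + 1) (by linarith)) h1
    have hN : 0 ≤ |A| ^ 2 := by positivity
    exact abs_le_of_sq_le_sq (this.trans (by nlinarith)) (by positivity)

end SobolevBounds

section WeightedEnergy

variable {k : ℕ} {u : ℝ × ℝ → ℝ} {W W1 W2 W3 : ℝ → ℝ} {p q : ℝ}

lemma hasDerivAt_integral_of_continuous {F F' : ℝ × ℝ → ℝ} (hF : Continuous F)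
    (hF' : Continuous F') (h : ∀ x t, HasDerivAt (fun s => F (x, s)) (F' (x, t)) t) (p q t : ℝ) :
    HasDerivAt (fun s => ∫ x in p..q, F (x, s)) (∫ x in p..q, F' (x, t)) t := by
  obtain ⟨C, hC⟩ := (isCompact_uIcc (a := p) (b := q)).prod
    (isCompact_Icc (a := t - 1) (b := t + 1)) |>.exists_bound_of_continuousOn hF'.continuousOn
  refine (intervalIntegral.hasDerivAt_integral_of_dominated_loc_of_deriv_le
    (F := fun s x => F (x, s)) (F' := fun s x => F' (x, s))
    (s := Set.Icc (t - 1) (t + 1)) (bound := fun _ => C)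
    (Icc_mem_nhds (by linarith) (by linarith))
    (Filter.Eventually.of_forall fun s => Continuous.aestronglyMeasurable (by fun_prop))
    (Continuous.intervalIntegrable (by fun_prop) _ _)
    (Continuous.aestronglyMeasurable (by fun_prop))
    (ae_of_all _ fun x hx s hs => hC (x, s) ⟨Set.uIoc_subset_uIcc hx, hs⟩)
    (intervalIntegrable_const) (ae_of_all _ fun x _ s _ => h x s)).2

lemma weighted_energy_identity (hu : ContDiff ℝ (⊤ : ℕ∞) u)
    (hpde : ∀ p : ℝ × ℝ, pdt u p + pdx (pdx (pdx u)) p + (u p) ^ k * pdx u p = 0)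
    (h0 : ∀ x, HasDerivAt W (W1 x) x) (h1 : ∀ x, HasDerivAt W1 (W2 x) x)
    (h2 : ∀ x, HasDerivAt W2 (W3 x) x) (h3 : Continuous W3)
    (hp0 : W p = 0) (hp1 : W1 p = 0) (hp2 : W2 p = 0)
    (hq0 : W q = 0) (hq1 : W1 q = 0) (hq2 : W2 q = 0) (t : ℝ) :
    HasDerivAt (fun s => ∫ x in p..q, u (x, s) ^ 2 * W x)
      (∫ x in p..q, (-3 * pdx u (x, t) ^ 2 * W1 x + u (x, t) ^ 2 * W3 x
        + 2 / (k + 2) * u (x, t) ^ (k + 2) * W1 x)) t := by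
  have cont : ∀ {f f' : ℝ → ℝ}, (∀ x, HasDerivAt f (f' x) x) → Continuous f := fun h =>
    continuous_iff_continuousAt.2 fun x => (h x).continuousAt
  have cW := cont h0
  have cW1 := cont h1
  have cW2 := cont h2
  have c0 := hu.continuous
  have c1 := hu.pdx.continuous
  have c2 := hu.pdx.pdx.continuous
  have c3 := hu.pdx.pdx.pdx.continuous
  have ct := hu.pdt.continuous
  have hd := hasDerivAt_integral_of_continuous (F := fun z => u z ^ 2 * W z.1)
    (F' := fun z => 2 * u z * pdt u z * W z.1) (by fun_prop) (by fun_prop)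
    (fun x t => by
      simpa using ((hu.hasDerivAt_pdt x t).pow 2).mul_const (W x)) p q t
  refine hd.congr_deriv ?_
  rw [← sub_eq_zero, ← intervalIntegral.integral_sub
    (Continuous.intervalIntegrable (by fun_prop) _ _)
    (Continuous.intervalIntegrable (by fun_prop) _ _)]
  have e0 := fun x => hu.hasDerivAt_pdx x t
  have e1 := fun x => hu.pdx.hasDerivAt_pdx x t
  have e2 := fun x => hu.pdx.pdx.hasDerivAt_pdx x t
  have d1 := fun x => (((e0 x).mul (e2 x)).mul (h0 x)).const_mul (-2)
  have d2 := fun x => (((e1 x).pow 2).mul (h0 x))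
  have d3 := fun x => (((e0 x).mul (e1 x)).mul (h1 x)).const_mul 2
  have d4 := fun x => (((e0 x).pow 2).mul (h2 x)).const_mul (-1)
  have d5 := fun x => (((e0 x).pow (k + 2)).mul (h0 x)).const_mul (-(2 / ((k : ℝ) + 2)))
  have key := fun x => (((d1 x).add (d2 x)).add ((d3 x).add (d4 x))).add (d5 x)
  rw [intervalIntegral.integral_eq_sub_of_hasDerivAt (fun x _ => (key x).congr_deriv ?_)
    (Continuous.intervalIntegrable (by fun_prop) _ _)]
  · simp [hp0, hp1, hp2, hq0, hq1, hq2]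
  · have hk : (k : ℝ) + 2 ≠ 0 := by positivity
    have := hpde (x, t)
    have ht : pdt u (x, t) = -pdx (pdx (pdx u)) (x, t) - u (x, t) ^ k * pdx u (x, t) := by
      linarith
    simp only [Pi.mul_apply, Pi.pow_apply, ht, Nat.cast_add, Nat.cast_ofNat,
      show k + 2 - 1 = k + 1 by omega]
    field_simp
    ring

lemma weighted_energy_estimate (hu : ContDiff ℝ (⊤ : ℕ∞) u)
    (hpde : ∀ p : ℝ × ℝ, pdt u p + pdx (pdx (pdx u)) p + (u p) ^ k * pdx u p = 0)
    (h0 : ∀ x, HasDerivAt W (W1 x) x) (h1 : ∀ x, HasDerivAt W1 (W2 x) x)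
    (h2 : ∀ x, HasDerivAt W2 (W3 x) x) (h3 : Continuous W3)
    (hp0 : W p = 0) (hp1 : W1 p = 0) (hp2 : W2 p = 0)
    (hq0 : W q = 0) (hq1 : W1 q = 0) (hq2 : W2 q = 0) (hpq : p ≤ q)
    {M K : ℝ} (hK : 0 ≤ K) (hW : ∀ x, 0 ≤ W x) (hl : ∀ x, -1 ≤ W1 x)
    (hW1 : ∀ x, |W1 x| ≤ K * W x + 1) (hW3 : ∀ x, W3 x ≤ K * W x + 1)
    (hM : ∀ t ∈ Set.Icc (0:ℝ) 1, ∀ x, |u (x, t)| ≤ M)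
    (hL0 : ∀ t ∈ Set.Icc (0:ℝ) 1, ∫ x in p..q, u (x, t) ^ 2 ≤ M)
    (hL1 : ∀ t ∈ Set.Icc (0:ℝ) 1, ∫ x in p..q, pdx u (x, t) ^ 2 ≤ M)
    {t : ℝ} (ht : t ∈ Set.Icc (0:ℝ) 1) :
    ∫ x in p..q, u (x, t) ^ 2 * W x ≤ Real.exp (K * (1 + M ^ k)) *
      ((∫ x in p..q, u (x, 0) ^ 2 * W x) + (4 + M ^ k) * M) := by
  have hM0 : 0 ≤ M := (abs_nonneg _).trans (hM t ht 0)
  have cont : ∀ {f f' : ℝ → ℝ}, (∀ x, HasDerivAt f (f' x) x) → Continuous f := fun h =>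
    continuous_iff_continuousAt.2 fun x => (h x).continuousAt
  have cW := cont h0
  have cW1 := cont h1
  have c0 := hu.continuous
  have c1 := hu.pdx.continuous
  set G : ℝ → ℝ := fun s => ∫ x in p..q, u (x, s) ^ 2 * W x with hG
  set D := (4 + M ^ k) * M with hD
  set κ := K * (1 + M ^ k) with hκ
  have hD0 : 0 ≤ D := by positivity
  have hκ0 : 0 ≤ κ := by positivity
  have hd := weighted_energy_identity hu hpde h0 h1 h2 h3 hp0 hp1 hp2 hq0 hq1 hq2
  set G' : ℝ → ℝ := fun t => ∫ x in p..q, (-3 * pdx u (x, t) ^ 2 * W1 x + u (x, t) ^ 2 * W3 x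
        + 2 / (k + 2) * u (x, t) ^ (k + 2) * W1 x) with hG'
  have hle : ∀ s ∈ Set.Icc (0:ℝ) 1, G' s ≤ κ * G s + D := by
    intro s hs
    have hi := fun (f : ℝ → ℝ) (hf : Continuous f) => hf.intervalIntegrable (μ := volume) p q
    calc G' s ≤ ∫ x in p..q, (κ * (u (x, s) ^ 2 * W x)
          + (3 * pdx u (x, s) ^ 2 + (1 + M ^ k) * u (x, s) ^ 2)) := by
          refine intervalIntegral.integral_mono_on hpq (hi _ (by fun_prop)) (hi _ (by fun_prop))
            fun x _ => ?_
          have a1 : -3 * pdx u (x, s) ^ 2 * W1 x ≤ 3 * pdx u (x, s) ^ 2 := by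
            nlinarith [hl x, sq_nonneg (pdx u (x, s))]
          have a2 := mul_le_mul_of_nonneg_left (hW3 x) (sq_nonneg (u (x, s)))
          have a3 : 2 / ((k : ℝ) + 2) * u (x, s) ^ (k + 2) * W1 x
              ≤ M ^ k * u (x, s) ^ 2 * (K * W x + 1) := by
            refine (le_abs_self _).trans ?_
            rw [abs_mul, abs_mul, abs_pow, pow_add, sq_abs]
            have b1 : |2 / ((k : ℝ) + 2)| ≤ 1 := by
              rw [abs_of_nonneg (by positivity), div_le_one (by positivity)]
              linarith [(Nat.cast_nonneg k : (0:ℝ) ≤ k)]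
            have b2 : |u (x, s)| ^ k ≤ M ^ k := pow_le_pow_left₀ (abs_nonneg _) (hM s hs x) k
            have b3 := hW1 x
            calc _ ≤ 1 * (M ^ k * u (x, s) ^ 2) * (K * W x + 1) := by gcongr
              _ = _ := by ring
          simp only [hκ]
          linarith
      _ = κ * G s + (3 * (∫ x in p..q, pdx u (x, s) ^ 2)
          + (1 + M ^ k) * ∫ x in p..q, u (x, s) ^ 2) := by
          rw [intervalIntegral.integral_add (hi _ (by fun_prop)) (hi _ (by fun_prop)),
            intervalIntegral.integral_add (hi _ (by fun_prop)) (hi _ (by fun_prop)),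
            intervalIntegral.integral_const_mul, intervalIntegral.integral_const_mul,
            intervalIntegral.integral_const_mul]
      _ ≤ _ := by
          have := mul_le_mul_of_nonneg_left (hL0 s hs) (by positivity : 0 ≤ 1 + M ^ k)
          have := hL1 s hs
          simp only [hD]
          linarith
  have hanti : AntitoneOn (fun s => Real.exp (-(κ * s)) * G s - D * s) (Set.Icc (0:ℝ) 1) := by
    have hder : ∀ s, HasDerivAt (fun s => Real.exp (-(κ * s)) * G s - D * s)
        (Real.exp (-(κ * s)) * (G' s - κ * G s) - D) s := by
      intro s
      have e1 : HasDerivAt (fun s => Real.exp (-(κ * s))) (Real.exp (-(κ * s)) * (-(κ * 1))) s :=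
        (((hasDerivAt_id s).const_mul κ).neg).exp
      have e2 : HasDerivAt (fun s => D * s) (D * 1) s := (hasDerivAt_id s).const_mul D
      exact ((e1.mul (hd s)).sub e2).congr_deriv (by ring)
    refine antitoneOn_of_deriv_nonpos (convex_Icc 0 1)
      (fun s _ => (hder s).continuousAt.continuousWithinAt)
      (fun s _ => (hder s).differentiableAt.differentiableWithinAt) fun s hs => ?_
    rw [interior_Icc] at hs
    rw [(hder s).deriv]
    have b1 := hle s ⟨hs.1.le, hs.2.le⟩
    have b2 : Real.exp (-(κ * s)) ≤ 1 := Real.exp_le_one_iff.2 (by nlinarith [hs.1])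
    nlinarith [Real.exp_pos (-(κ * s))]
  have hfin := hanti (Set.left_mem_Icc.2 zero_le_one) ht ht.1
  simp only [mul_zero, neg_zero, Real.exp_zero, one_mul, sub_zero] at hfin
  have hG0 : 0 ≤ G 0 := intervalIntegral.integral_nonneg hpq fun x _ =>
    mul_nonneg (sq_nonneg _) (hW x)
  have h4 : Real.exp (-(κ * t)) * G t ≤ G 0 + D := by nlinarith [ht.2]
  calc G t = Real.exp (κ * t) * (Real.exp (-(κ * t)) * G t) := by
        rw [← mul_assoc, ← Real.exp_add]; simp
    _ ≤ Real.exp (κ * t) * (G 0 + D) := by gcongr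
    _ ≤ Real.exp κ * (G 0 + D) := by
        gcongr
        nlinarith [ht.2]

end WeightedEnergy

section Cutoff

lemma exists_bound_of_eq_zero_outside {g : ℝ → ℝ} (hg : Continuous g) {a b : ℝ}
    (ha : ∀ x ≤ a, g x = 0) (hb : ∀ x, b ≤ x → g x = 0) : ∃ C, ∀ x, |g x| ≤ C := by
  obtain ⟨C, hC⟩ := (isCompact_Icc (a := a) (b := b)).exists_bound_of_continuousOn hg.continuousOn
  refine ⟨|C|, fun x => ?_⟩
  rcases le_or_gt x a with h | h
  · simp [ha x h]
  rcases le_or_gt b x with h' | h'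
  · simp [hb x h']
  · exact (hC x ⟨h.le, h'.le⟩).trans (le_abs_self C)

/-- A smooth function vanishing outside `[a, b]` has two bounded derivatives vanishing there. -/
lemma exists_derivs_bound_of_eq_zero_outside {g : ℝ → ℝ} (hg : ContDiff ℝ (⊤ : ℕ∞) g) {a b : ℝ}
    (ha : ∀ x ≤ a, g x = 0) (hb : ∀ x, b ≤ x → g x = 0) :
    ContDiff ℝ (⊤ : ℕ∞) (deriv (deriv g)) ∧
    (∀ x, HasDerivAt g (deriv g x) x) ∧ (∀ x, HasDerivAt (deriv g) (deriv (deriv g) x) x) ∧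
    (∀ x, x ≤ a ∨ b ≤ x → g x = 0 ∧ deriv g x = 0 ∧ deriv (deriv g) x = 0) ∧
    ∃ C, ∀ x, |g x| ≤ C ∧ |deriv g x| ≤ C ∧ |deriv (deriv g) x| ≤ C := by
  obtain ⟨d0, hg1⟩ := contDiff_infty_iff_deriv.1 hg
  obtain ⟨d1, hg2⟩ := contDiff_infty_iff_deriv.1 hg1
  have a1 := deriv_eq_zero_of_forall_le d0 ha
  have a2 := deriv_eq_zero_of_forall_le d1 a1
  have b1 := deriv_eq_zero_of_forall_ge d0 hb
  have b2 := deriv_eq_zero_of_forall_ge d1 b1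
  obtain ⟨C0, h0⟩ := exists_bound_of_eq_zero_outside hg.continuous ha hb
  obtain ⟨C1, h1⟩ := exists_bound_of_eq_zero_outside hg1.continuous a1 b1
  obtain ⟨C2, h2⟩ := exists_bound_of_eq_zero_outside hg2.continuous a2 b2
  refine ⟨hg2, fun x => (d0 x).hasDerivAt, fun x => (d1 x).hasDerivAt, fun x hx => ?_,
    max C0 (max C1 C2), fun x => ⟨?_, ?_, ?_⟩⟩
  · rcases hx with hx | hx
    exacts [⟨ha x hx, a1 x hx, a2 x hx⟩, ⟨hb x hx, b1 x hx, b2 x hx⟩]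
  · exact (h0 x).trans (le_max_left _ _)
  · exact (h1 x).trans ((le_max_left _ _).trans (le_max_right _ _))
  · exact (h2 x).trans ((le_max_right _ _).trans (le_max_right _ _))

lemma exists_bump : ∃ (h h1 h2 h3 : ℝ → ℝ) (C : ℝ), (∀ x, HasDerivAt h (h1 x) x) ∧
    (∀ x, HasDerivAt h1 (h2 x) x) ∧ (∀ x, HasDerivAt h2 (h3 x) x) ∧ Continuous h3 ∧
    (∀ x, 0 ≤ h x ∧ h x ≤ 1) ∧ (∀ x, -1 ≤ x → x ≤ 1 → h x = 1) ∧
    (∀ x, x ≤ -2 ∨ 2 ≤ x → h x = 0 ∧ h1 x = 0 ∧ h2 x = 0) ∧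
    ∀ x, |h1 x| ≤ C ∧ |h2 x| ≤ C ∧ |h3 x| ≤ C := by
  set g : ℝ → ℝ := fun x => Real.smoothTransition (2 - x) * Real.smoothTransition (2 + x) with hg
  have hs : ContDiff ℝ (⊤ : ℕ∞) g :=
    (Real.smoothTransition.contDiff.comp (contDiff_const.sub contDiff_id)).mul
      (Real.smoothTransition.contDiff.comp (contDiff_const.add contDiff_id))
  have ga : ∀ x ≤ -2, g x = 0 := fun x hx => by
    simp [hg, Real.smoothTransition.zero_of_nonpos (show 2 + x ≤ 0 by linarith)]
  have gb : ∀ x, 2 ≤ x → g x = 0 := fun x hx => by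
    simp [hg, Real.smoothTransition.zero_of_nonpos (show 2 - x ≤ 0 by linarith)]
  obtain ⟨d0, hs1⟩ := contDiff_infty_iff_deriv.1 hs
  obtain ⟨-, e0, e1, ez, -⟩ := exists_derivs_bound_of_eq_zero_outside hs ga gb
  obtain ⟨c3, -, e2, -, C, hC⟩ := exists_derivs_bound_of_eq_zero_outside hs1
    (fun x hx => (ez x (Or.inl hx)).2.1) (fun x hx => (ez x (Or.inr hx)).2.1)
  refine ⟨g, _, _, _, C, e0, e1, e2, c3.continuous, fun x => ⟨?_, ?_⟩, fun x h1 h2 => ?_, ez, hC⟩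
  · exact mul_nonneg (Real.smoothTransition.nonneg _) (Real.smoothTransition.nonneg _)
  · exact mul_le_one₀ (Real.smoothTransition.le_one _) (Real.smoothTransition.nonneg _)
      (Real.smoothTransition.le_one _)
  · simp only [hg]
    rw [Real.smoothTransition.one_of_one_le (by linarith),
      Real.smoothTransition.one_of_one_le (by linarith), one_mul]

end Cutoff

section Decay

/-- Bounded substitutes for the weight `exp (gam * x)`, truncated to a compact set. -/
lemma exists_truncated_exp_weight {gam eps R0 : ℝ} (hgam : 0 ≤ gam) (heps : 0 < eps) :
    ∃ (R : ℝ) (W W1 W2 W3 : ℝ → ℝ), R0 ≤ R ∧ 1 ≤ R ∧ (∀ x, HasDerivAt W (W1 x) x) ∧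
      (∀ x, HasDerivAt W1 (W2 x) x) ∧ (∀ x, HasDerivAt W2 (W3 x) x) ∧ Continuous W3 ∧
      (∀ x, x = -(2 * R) ∨ x = 2 * R → W x = 0 ∧ W1 x = 0 ∧ W2 x = 0) ∧
      (∀ x, 0 ≤ W x) ∧ (∀ x, -1 ≤ W1 x) ∧ (∀ x, |W1 x| ≤ (gam + gam ^ 3) * W x + 1) ∧
      (∀ x, W3 x ≤ (gam + gam ^ 3) * W x + 1) ∧ (∀ x, W x ≤ Real.exp (gam * x)) ∧
      ∀ x, |x| ≤ R → W x = (Real.exp (-(gam * x)) + eps)⁻¹ := by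
  obtain ⟨h, h1, h2, h3, C, e0, e1, e2, c3, hr, ho, hz, hC⟩ := exists_bump
  have hC0 : 0 ≤ C := (abs_nonneg _).trans (hC 0).1
  set P : ℝ := C * (3 * gam ^ 2 + 3 * gam + 1) / eps with hP
  have hP0 : 0 ≤ P := by positivity
  obtain ⟨R, hR0, hR1, hRP⟩ : ∃ R, R0 ≤ R ∧ 1 ≤ R ∧ P ≤ R :=
    ⟨max R0 (max 1 P), le_max_left _ _, (le_max_left _ _).trans (le_max_right _ _),
      (le_max_right _ _).trans (le_max_right _ _)⟩
  have hRpos : 0 < R := by linarith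
  set w : ℝ → ℝ := fun x => (Real.exp (-(gam * x)) + eps)⁻¹ with hw
  have hden : ∀ x, 0 < Real.exp (-(gam * x)) + eps := fun x => by positivity
  have hw0 : ∀ x, 0 < w x := fun x => inv_pos.2 (hden x)
  have hwe : ∀ x, eps * w x ≤ 1 := fun x => by
    rw [hw]
    simp only
    rw [← div_eq_mul_inv, div_le_one (hden x)]
    linarith [Real.exp_pos (-(gam * x))]
  have dw : ∀ x, HasDerivAt w (gam * w x * (1 - eps * w x)) x := by
    intro x
    have e : HasDerivAt (fun x => Real.exp (-(gam * x)) + eps)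
        (Real.exp (-(gam * x)) * (-(gam * 1))) x :=
      ((((hasDerivAt_id x).const_mul gam).neg).exp).add_const eps
    refine (e.inv (hden x).ne').congr_deriv ?_
    have := (hden x).ne'
    simp only [hw]
    field_simp
    ring
  have dw1 : ∀ x, HasDerivAt (fun x => gam * w x * (1 - eps * w x))
      (gam ^ 2 * w x * (1 - eps * w x) * (1 - 2 * (eps * w x))) x := fun x =>
    (((dw x).const_mul gam).mul (((dw x).const_mul eps).const_sub 1)).congr_deriv (by ring)
  have dw2 : ∀ x, HasDerivAt (fun x => gam ^ 2 * w x * (1 - eps * w x) * (1 - 2 * (eps * w x)))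
      (gam ^ 3 * w x * (1 - eps * w x)
        * ((1 - 2 * (eps * w x)) ^ 2 - 2 * (eps * w x) * (1 - eps * w x))) x := fun x =>
    ((((dw x).const_mul (gam ^ 2)).mul (((dw x).const_mul eps).const_sub 1)).mul
      ((((dw x).const_mul eps).const_mul 2).const_sub 1)).congr_deriv
      (by simp only [Pi.mul_apply]; ring)
  have scale : ∀ {f f' : ℝ → ℝ}, (∀ x, HasDerivAt f (f' x) x) → ∀ x,
      HasDerivAt (fun x => f (x / R)) (f' (x / R) / R) x := by
    intro f f' hf x
    exact ((hf (x / R)).comp x ((hasDerivAt_id x).div_const R)).congr_deriv (by ring)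
  have s0 := scale e0
  have s1 := fun x => (scale e1 x).div_const R
  have s2 := fun x => ((scale e2 x).div_const R).div_const R
  have cw : Continuous w := continuous_iff_continuousAt.2 fun x => (dw x).continuousAt
  have ch : ∀ {f f' : ℝ → ℝ}, (∀ x, HasDerivAt f (f' x) x) → Continuous f := fun h =>
    continuous_iff_continuousAt.2 fun x => (h x).continuousAt
  have ch0 := ch e0
  have ch1 := ch e1
  have ch2 := ch e2
  have hwb : ∀ x, w x ≤ 1 / eps := fun x => by
    rw [le_div_iff₀ heps]; linarith [hwe x]
  have small : ∀ x, w x * (C / R) * (3 * gam ^ 2 + 3 * gam + 1) ≤ 1 := by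
    intro x
    have : 1 / eps * (C / R) * (3 * gam ^ 2 + 3 * gam + 1) ≤ 1 := by
      have e : 1 / eps * (C / R) * (3 * gam ^ 2 + 3 * gam + 1) = P / R := by
        simp only [hP]; field_simp
      rw [e, div_le_one hRpos]; exact hRP
    refine le_trans ?_ this
    gcongr
    exact hwb x
  have b1 : ∀ x, |h1 (x / R) / R| ≤ C / R := fun x => by
    rw [abs_div, abs_of_pos hRpos]; gcongr; exact (hC _).1
  have b2 : ∀ x, |h2 (x / R) / R / R| ≤ C / R := fun x => by
    rw [abs_div, abs_div, abs_of_pos hRpos]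
    exact (div_le_self (by positivity) hR1).trans (by gcongr; exact (hC _).2.1)
  have b3 : ∀ x, |h3 (x / R) / R / R / R| ≤ C / R := fun x => by
    rw [abs_div, abs_div, abs_div, abs_of_pos hRpos]
    exact (div_le_self (by positivity) hR1).trans
      ((div_le_self (by positivity) hR1).trans (by gcongr; exact (hC _).2.2))
  have small1 : ∀ x, |w x * (h1 (x / R) / R)| ≤ 1 := by
    intro x
    rw [abs_mul, abs_of_pos (hw0 x)]
    have h4 : w x * |h1 (x / R) / R| ≤ w x * (C / R) :=
      mul_le_mul_of_nonneg_left (b1 x) (hw0 x).le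
    have h5 : 0 ≤ w x * (C / R) * (3 * gam ^ 2 + 3 * gam) := by
      have := (hw0 x).le; positivity
    linarith [small x]
  refine ⟨R, fun x => w x * h (x / R),
    fun x => gam * w x * (1 - eps * w x) * h (x / R) + w x * (h1 (x / R) / R),
    fun x => gam ^ 2 * w x * (1 - eps * w x) * (1 - 2 * (eps * w x)) * h (x / R)
      + 2 * (gam * w x * (1 - eps * w x)) * (h1 (x / R) / R) + w x * (h2 (x / R) / R / R),
    fun x => gam ^ 3 * w x * (1 - eps * w x)
        * ((1 - 2 * (eps * w x)) ^ 2 - 2 * (eps * w x) * (1 - eps * w x)) * h (x / R)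
      + 3 * (gam ^ 2 * w x * (1 - eps * w x) * (1 - 2 * (eps * w x))) * (h1 (x / R) / R)
      + 3 * (gam * w x * (1 - eps * w x)) * (h2 (x / R) / R / R)
      + w x * (h3 (x / R) / R / R / R), hR0, hR1, ?_, ?_, ?_, ?_, ?_, ?_, ?_, ?_, ?_, ?_, ?_⟩
  · exact fun x => (dw x).mul (s0 x)
  · exact fun x => (((dw1 x).mul (s0 x)).add ((dw x).mul (s1 x))).congr_deriv (by ring)
  · exact fun x => ((((dw2 x).mul (s0 x)).add (((dw1 x).const_mul 2).mul (s1 x))).add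
      ((dw x).mul (s2 x))).congr_deriv (by ring)
  · fun_prop
  · intro x hx
    have : x / R ≤ -2 ∨ 2 ≤ x / R := by
      rcases hx with rfl | rfl
      · left; rw [neg_div, mul_div_cancel_right₀ _ hRpos.ne']
      · right; rw [mul_div_cancel_right₀ _ hRpos.ne']
    obtain ⟨z0, z1, z2⟩ := hz _ this
    simp [z0, z1, z2]
  · exact fun x => mul_nonneg (hw0 x).le (hr _).1
  · intro x
    have h4 : 0 ≤ gam * w x * (1 - eps * w x) * h (x / R) :=
      mul_nonneg (mul_nonneg (mul_nonneg hgam (hw0 x).le) (by linarith [hwe x])) (hr _).1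
    linarith [(abs_le.1 (small1 x)).1]
  · intro x
    have h4 : 0 ≤ gam * (w x * h (x / R)) := mul_nonneg hgam (mul_nonneg (hw0 x).le (hr _).1)
    have h5 : 0 ≤ 1 - eps * w x := by linarith [hwe x]
    have h6 : 1 - eps * w x ≤ 1 := by linarith [mul_pos heps (hw0 x)]
    refine (abs_add_le _ _).trans (add_le_add ?_ (small1 x))
    rw [show gam * w x * (1 - eps * w x) * h (x / R)
      = gam * (w x * h (x / R)) * (1 - eps * w x) by ring, abs_of_nonneg (mul_nonneg h4 h5)]
    have h7 : 0 ≤ gam ^ 3 * (w x * h (x / R)) :=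
      mul_nonneg (by positivity) (mul_nonneg (hw0 x).le (hr _).1)
    nlinarith
  · intro x
    have h4 : 0 ≤ w x * h (x / R) := mul_nonneg (hw0 x).le (hr _).1
    set v := eps * w x with hv
    have h5 : 0 ≤ 1 - v := by linarith [hwe x]
    have h6 : 0 ≤ v := (mul_pos heps (hw0 x)).le
    have h7 : (1 - v) * ((1 - 2 * v) ^ 2 - 2 * v * (1 - v)) ≤ 1 := by
      nlinarith [mul_nonneg h5 h6, mul_nonneg (mul_nonneg h5 h6) h5]
    have h8 : gam ^ 3 * w x * (1 - v) * ((1 - 2 * v) ^ 2 - 2 * v * (1 - v)) * h (x / R)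
        ≤ gam ^ 3 * (w x * h (x / R)) := by
      have := mul_le_mul_of_nonneg_left h7 (mul_nonneg (pow_nonneg hgam 3) h4)
      linarith
    have h9 : |(1 - v) * (1 - 2 * v)| ≤ 1 := by
      rw [abs_le]; constructor <;> nlinarith
    have h10 : |1 - v| ≤ 1 := by rw [abs_of_nonneg h5]; linarith
    have k1 : gam ^ 2 * w x * (1 - v) * (1 - 2 * v) * (h1 (x / R) / R)
        ≤ gam ^ 2 * w x * (C / R) := by
      refine (le_abs_self _).trans ?_
      rw [show gam ^ 2 * w x * (1 - v) * (1 - 2 * v) * (h1 (x / R) / R)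
        = gam ^ 2 * w x * (((1 - v) * (1 - 2 * v)) * (h1 (x / R) / R)) by ring, abs_mul,
        abs_of_nonneg (mul_nonneg (sq_nonneg gam) (hw0 x).le), abs_mul]
      refine mul_le_mul_of_nonneg_left ?_ (mul_nonneg (sq_nonneg gam) (hw0 x).le)
      exact (mul_le_mul h9 (b1 x) (abs_nonneg _) zero_le_one).trans (one_mul _).le
    have k2 : gam * w x * (1 - v) * (h2 (x / R) / R / R) ≤ gam * w x * (C / R) := by
      refine (le_abs_self _).trans ?_
      rw [show gam * w x * (1 - v) * (h2 (x / R) / R / R)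
        = gam * w x * ((1 - v) * (h2 (x / R) / R / R)) by ring, abs_mul,
        abs_of_nonneg (mul_nonneg hgam (hw0 x).le), abs_mul]
      refine mul_le_mul_of_nonneg_left ?_ (mul_nonneg hgam (hw0 x).le)
      exact (mul_le_mul h10 (b2 x) (abs_nonneg _) zero_le_one).trans (one_mul _).le
    have k3 : w x * (h3 (x / R) / R / R / R) ≤ w x * (C / R) :=
      mul_le_mul_of_nonneg_left ((le_abs_self _).trans (b3 x)) (hw0 x).le
    have h11 := mul_nonneg hgam h4
    have := small x
    linarith
  · intro x
    have h4 : w x * h (x / R) ≤ w x * 1 := mul_le_mul_of_nonneg_left (hr _).2 (hw0 x).le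
    have h5 : w x ≤ Real.exp (gam * x) := by
      rw [← neg_neg (gam * x), Real.exp_neg (-(gam * x))]
      exact inv_anti₀ (Real.exp_pos _) (by linarith)
    linarith
  · intro x hx
    have h4 := abs_le.1 hx
    simp only
    rw [ho _ (by rw [le_div_iff₀ hRpos]; linarith) (by rw [div_le_one hRpos]; linarith), mul_one]

variable {k : ℕ} {u : ℝ × ℝ → ℝ}

lemma exists_local_L2_decay (hu : ContDiff ℝ (⊤ : ℕ∞) u)
    (hpde : ∀ p : ℝ × ℝ, pdt u p + pdx (pdx (pdx u)) p + (u p) ^ k * pdx u p = 0)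
    {b M : ℝ} (hsupp0 : ∀ x : ℝ, b ≤ x → u (x, 0) = 0)
    (hM : ∀ t ∈ Set.Icc (0:ℝ) 1, ∀ x, |u (x, t)| ≤ M)
    (hL0 : ∀ t ∈ Set.Icc (0:ℝ) 1, ∀ p q, p ≤ q → ∫ x in p..q, u (x, t) ^ 2 ≤ M)
    (hL1 : ∀ t ∈ Set.Icc (0:ℝ) 1, ∀ p q, p ≤ q → ∫ x in p..q, pdx u (x, t) ^ 2 ≤ M)
    {gam : ℝ} (hgam : 0 ≤ gam) :
    ∃ C, ∀ t ∈ Set.Icc (0:ℝ) 1, ∀ x, ∫ y in x..x + 1, u (y, t) ^ 2 ≤ C * Real.exp (-(gam * x)) := by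
  set Q := Real.exp ((gam + gam ^ 3) * (1 + M ^ k)) *
    (Real.exp (gam * b) * M + (4 + M ^ k) * M) with hQ
  refine ⟨2 * Q, fun t ht x => ?_⟩
  obtain ⟨R, W, W1, W2, W3, hR0, hR1, d0, d1, d2, c3, hz, hW, hW1l, hW1, hW3, hWe, hWR⟩ :=
    exists_truncated_exp_weight (R0 := |x| + 1) hgam (Real.exp_pos (-(gam * x)))
  have cW : Continuous W := continuous_iff_continuousAt.2 fun x => (d0 x).continuousAt
  have c0 := hu.continuous
  have hi := fun (f : ℝ → ℝ) (hf : Continuous f) (p q : ℝ) =>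
    hf.intervalIntegrable (μ := volume) p q
  obtain ⟨zl0, zl1, zl2⟩ := hz _ (Or.inl rfl)
  obtain ⟨zr0, zr1, zr2⟩ := hz _ (Or.inr rfl)
  have hRR : -(2 * R) ≤ 2 * R := by linarith
  have hmain := weighted_energy_estimate hu hpde d0 d1 d2 c3 zl0 zl1 zl2 zr0 zr1 zr2 hRR
    (by positivity) hW hW1l hW1 hW3 hM (fun t ht => hL0 t ht _ _ hRR)
    (fun t ht => hL1 t ht _ _ hRR) ht
  have hbegin : ∫ y in -(2 * R)..2 * R, u (y, 0) ^ 2 * W y ≤ Real.exp (gam * b) * M := by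
    calc _ ≤ ∫ y in -(2 * R)..2 * R, Real.exp (gam * b) * u (y, 0) ^ 2 := by
          refine intervalIntegral.integral_mono_on hRR (hi _ (by fun_prop) _ _)
            (hi _ (by fun_prop) _ _) fun y _ => ?_
          rcases le_or_gt b y with h | h
          · simp [hsupp0 y h]
          · rw [mul_comm]
            refine mul_le_mul_of_nonneg_right ((hWe y).trans ?_) (sq_nonneg _)
            exact Real.exp_le_exp.2 (mul_le_mul_of_nonneg_left h.le hgam)
      _ ≤ _ := by
          rw [intervalIntegral.integral_const_mul]
          exact mul_le_mul_of_nonneg_left (hL0 0 (by simp) _ _ hRR) (Real.exp_pos _).le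
  have hx := abs_le.1 (le_refl |x|)
  have hloc : ∫ y in x..x + 1, u (y, t) ^ 2 * W y ≤ Q := by
    calc _ ≤ ∫ y in -(2 * R)..2 * R, u (y, t) ^ 2 * W y := by
          refine intervalIntegral.integral_mono_interval (by linarith) (by linarith) (by linarith)
            (ae_of_all _ fun y => mul_nonneg (sq_nonneg _) (hW y)) (hi _ (by fun_prop) _ _)
      _ ≤ _ := hmain
      _ ≤ Q := by
          simp only [hQ]
          gcongr
  calc ∫ y in x..x + 1, u (y, t) ^ 2
      ≤ ∫ y in x..x + 1, 2 * Real.exp (-(gam * x)) * (u (y, t) ^ 2 * W y) := by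
        refine intervalIntegral.integral_mono_on (by linarith) (hi _ (by fun_prop) _ _)
          (hi _ (by fun_prop) _ _) fun y hy => ?_
        rw [hWR y (abs_le.2 ⟨by linarith [hy.1, hy.2], by linarith [hy.1, hy.2]⟩)]
        have h1 : Real.exp (-(gam * y)) ≤ Real.exp (-(gam * x)) :=
          Real.exp_le_exp.2 (neg_le_neg (mul_le_mul_of_nonneg_left hy.1 hgam))
        have h2 := Real.exp_pos (-(gam * y))
        have h3 : 1 ≤ 2 * Real.exp (-(gam * x)) *
            (Real.exp (-(gam * y)) + Real.exp (-(gam * x)))⁻¹ := by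
          rw [← div_eq_mul_inv, one_le_div (by linarith)]
          linarith
        nlinarith [mul_le_mul_of_nonneg_left h3 (sq_nonneg (u (y, t)))]
    _ ≤ 2 * Real.exp (-(gam * x)) * Q := by
        rw [intervalIntegral.integral_const_mul]
        gcongr
    _ = _ := by ring

/-- Faster than exponential decay on the right, uniformly for `t ∈ [0, 1]`. -/
def RapidDecay (g : ℝ × ℝ → ℝ) : Prop :=
  ∀ β, 0 ≤ β → ∃ C, ∀ t ∈ Set.Icc (0:ℝ) 1, ∀ x, |g (x, t)| ≤ C * Real.exp (-(β * x))

lemma RapidDecay.pdx {g : ℝ × ℝ → ℝ} (hd : RapidDecay g) (hg : ContDiff ℝ (⊤ : ℕ∞) g) {M : ℝ}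
    (hM : ∀ t ∈ Set.Icc (0:ℝ) 1, ∀ x, |_root_.pdx (_root_.pdx g) (x, t)| ≤ M) :
    RapidDecay (_root_.pdx g) := by
  intro β hβ
  obtain ⟨C, hC⟩ := hd (2 * β) (by positivity)
  have hC0 : 0 ≤ C := by
    have := hC 0 (by simp) 0
    simp only [mul_zero, neg_zero, Real.exp_zero, mul_one] at this
    exact (abs_nonneg _).trans this
  refine ⟨2 * C + M, fun t ht x => ?_⟩
  have h := abs_deriv_le_of_abs_le (fun y => hg.hasDerivAt_pdx y t)
    (fun y => hg.pdx.hasDerivAt_pdx y t) (x := x) (A := C * Real.exp (-(2 * β * x)))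
    (Real.exp_pos (-(β * x))) (fun y hy => (hC t ht y).trans ?_) (fun y => hM t ht y)
  · refine h.trans (le_of_eq ?_)
    rw [show -(2 * β * x) = -(β * x) + -(β * x) by ring, Real.exp_add]
    field_simp
  · gcongr

lemma rapidDecay_of_support (hu : ContDiff ℝ (⊤ : ℕ∞) u)
    (hpde : ∀ p : ℝ × ℝ, pdt u p + pdx (pdx (pdx u)) p + (u p) ^ k * pdx u p = 0)
    {b M : ℝ} (hsupp0 : ∀ x : ℝ, b ≤ x → u (x, 0) = 0)
    (hM : ∀ t ∈ Set.Icc (0:ℝ) 1, ∀ x, |u (x, t)| ≤ M)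
    (hM1 : ∀ t ∈ Set.Icc (0:ℝ) 1, ∀ x, |pdx u (x, t)| ≤ M)
    (hL0 : ∀ t ∈ Set.Icc (0:ℝ) 1, ∀ p q, p ≤ q → ∫ x in p..q, u (x, t) ^ 2 ≤ M)
    (hL1 : ∀ t ∈ Set.Icc (0:ℝ) 1, ∀ p q, p ≤ q → ∫ x in p..q, pdx u (x, t) ^ 2 ≤ M) :
    RapidDecay u := by
  intro β hβ
  have hM0 : 0 ≤ M := (abs_nonneg _).trans (hM 0 (by simp) 0)
  obtain ⟨C, hC⟩ := exists_local_L2_decay hu hpde hsupp0 hM hL0 hL1 (gam := 4 * β) (by positivity)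
  have hC0 : 0 ≤ C := by
    have := hC 0 (by simp) 0
    simp only [mul_zero, neg_zero, Real.exp_zero, mul_one] at this
    exact (intervalIntegral.integral_nonneg (by simp) fun _ _ => sq_nonneg _).trans this
  refine ⟨2 * C + M ^ 2 + 1 + M, fun t ht x => ?_⟩
  rcases le_or_gt 0 x with hx | hx
  · have c1 := hu.pdx.continuous
    have h := sq_le_of_abs_deriv_le (x := x) (fun y => hu.hasDerivAt_pdx y t) (by fun_prop)
      (pow_pos (Real.exp_pos (-(β * x))) 2) (fun y => hM1 t ht y)
    have hE : Real.exp (-(4 * β * x)) = Real.exp (-(β * x)) ^ 4 := by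
      rw [← Real.exp_nat_mul]; congr 1; push_cast; ring
    have h2 := hC t ht x
    rw [hE] at h2
    have hE0 := Real.exp_pos (-(β * x))
    have hE1 : Real.exp (-(β * x)) ≤ 1 :=
      Real.exp_le_one_iff.2 (neg_nonpos.2 (mul_nonneg hβ hx))
    generalize Real.exp (-(β * x)) = E at *
    have h3 : (1 + 1 / E ^ 2) * (∫ y in x..x + 1, u (y, t) ^ 2) ≤ 2 * C * E ^ 2 := by
      calc _ ≤ (1 + 1 / E ^ 2) * (C * E ^ 4) := by gcongr
        _ = C * E ^ 2 * (E ^ 2 + 1) := by field_simp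
        _ ≤ C * E ^ 2 * (1 + 1) := by gcongr; exact pow_le_one₀ hE0.le hE1
        _ = _ := by ring
    have h4 : u (x, t) ^ 2 ≤ (2 * C + M ^ 2) * E ^ 2 := by linarith
    refine abs_le_of_sq_le_sq (h4.trans ?_) (by positivity)
    rw [mul_pow]
    gcongr
    nlinarith [sq_nonneg M]
  · have h1 : 1 ≤ Real.exp (-(β * x)) := Real.one_le_exp (by nlinarith)
    have h2 := hM t ht x
    nlinarith [sq_nonneg M]

end Decay

section Conjugation

variable {u v ζ : ℝ × ℝ → ℝ} {k : ℕ}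

/-- The integrated Carleman weight. -/
noncomputable def carlemanPhase (c lam kap t0 : ℝ) (p : ℝ × ℝ) : ℝ :=
  lam * (2 * p.1 + Real.exp (c - p.1)) - kap / 2 * (p.2 - t0) ^ 2

lemma contDiff_carlemanPhase (c lam kap t0 : ℝ) :
    ContDiff ℝ (⊤ : ℕ∞) (carlemanPhase c lam kap t0) := by
  unfold carlemanPhase
  fun_prop

lemma conjAiry_exp_mul (hv : ContDiff ℝ (⊤ : ℕ∞) v) (c lam kap t0 : ℝ) (p : ℝ × ℝ) :
    pdx (fun q => Real.exp (carlemanPhase c lam kap t0 q) * v q) p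
        = Real.exp (carlemanPhase c lam kap t0 p)
          * (pdx v p + lam * (2 - Real.exp (c - p.1)) * v p) ∧
      conjAiry c lam kap t0 (fun q => Real.exp (carlemanPhase c lam kap t0 q) * v q) p
        = Real.exp (carlemanPhase c lam kap t0 p) * (pdt v p + pdx (pdx (pdx v)) p) := by
  set P := carlemanPhase c lam kap t0 with hP
  have hE := fun x => hasDerivAt_exp_const_sub c x
  have hm : ∀ x, HasDerivAt (fun y => lam * (2 - Real.exp (c - y)))
      (lam * Real.exp (c - x)) x := fun x => by
    simpa using ((hE x).const_sub 2).const_mul lam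
  have hPx : ∀ x t, HasDerivAt (fun y => Real.exp (P (y, t)))
      (Real.exp (P (x, t)) * (lam * (2 - Real.exp (c - x)))) x := by
    intro x t
    refine HasDerivAt.exp ?_
    have := ((((hasDerivAt_id x).const_mul 2).add (hE x)).const_mul lam).sub_const
      (kap / 2 * (t - t0) ^ 2)
    refine this.congr_deriv ?_
    ring
  have hPt : ∀ x t, HasDerivAt (fun s => Real.exp (P (x, s)))
      (Real.exp (P (x, t)) * (-(kap * (t - t0)))) t := by
    intro x t
    refine HasDerivAt.exp ?_
    have := ((((hasDerivAt_id t).sub_const t0).pow 2).const_mul (kap / 2)).const_sub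
      (lam * (2 * x + Real.exp (c - x)))
    refine this.congr_deriv ?_
    simp
    ring
  have h0 := hv.hasDerivAt_pdx
  have h1 := hv.pdx.hasDerivAt_pdx
  have h2 := hv.pdx.pdx.hasDerivAt_pdx
  have e1 := pdx_eq_of_hasDerivAt (f := fun q => Real.exp (P q) * v q)
    (g := fun q => Real.exp (P q) * (pdx v q + lam * (2 - Real.exp (c - q.1)) * v q))
    fun x t => ((hPx x t).mul (h0 x t)).congr_deriv (by ring)
  have e2 := pdx_eq_of_hasDerivAt
    (f := fun q => Real.exp (P q) * (pdx v q + lam * (2 - Real.exp (c - q.1)) * v q))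
    (g := fun q => Real.exp (P q) * (pdx (pdx v) q
      + 2 * (lam * (2 - Real.exp (c - q.1))) * pdx v q
      + ((lam * (2 - Real.exp (c - q.1))) ^ 2 + lam * Real.exp (c - q.1)) * v q))
    fun x t => ((hPx x t).mul ((h1 x t).add ((hm x).mul (h0 x t)))).congr_deriv (by
      simp only [Pi.add_apply, Pi.mul_apply]; ring)
  have e3 := pdx_eq_of_hasDerivAt
    (f := fun q => Real.exp (P q) * (pdx (pdx v) q
      + 2 * (lam * (2 - Real.exp (c - q.1))) * pdx v q
      + ((lam * (2 - Real.exp (c - q.1))) ^ 2 + lam * Real.exp (c - q.1)) * v q))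
    (g := fun q => Real.exp (P q) * (pdx (pdx (pdx v)) q
      + 3 * (lam * (2 - Real.exp (c - q.1))) * pdx (pdx v) q
      + 3 * ((lam * (2 - Real.exp (c - q.1))) ^ 2 + lam * Real.exp (c - q.1)) * pdx v q
      + ((lam * (2 - Real.exp (c - q.1))) ^ 3
        + 3 * (lam * (2 - Real.exp (c - q.1))) * (lam * Real.exp (c - q.1))
        - lam * Real.exp (c - q.1)) * v q))
    fun x t => ((hPx x t).mul (((h2 x t).add (((hm x).const_mul 2).mul (h1 x t))).add
      ((((hm x).pow 2).add ((hE x).const_mul lam)).mul (h0 x t)))).congr_deriv (by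
      simp only [Pi.add_apply, Pi.mul_apply, Pi.pow_apply]; push_cast; ring)
  have et := pdt_eq_of_hasDerivAt (f := fun q => Real.exp (P q) * v q)
    (g := fun q => Real.exp (P q) * (pdt v q - kap * (q.2 - t0) * v q))
    fun x t => ((hPt x t).mul (hv.hasDerivAt_pdt x t)).congr_deriv (by ring)
  constructor
  · rw [e1]
  · unfold conjAiry
    rw [e1, e2, e3, et]
    ring

lemma airy_mul_of_pde (hu : ContDiff ℝ (⊤ : ℕ∞) u)
    (hpde : ∀ p : ℝ × ℝ, pdt u p + pdx (pdx (pdx u)) p + (u p) ^ k * pdx u p = 0)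
    (hζ : ContDiff ℝ (⊤ : ℕ∞) ζ) (p : ℝ × ℝ) :
    pdt (fun q => ζ q * u q) p + pdx (pdx (pdx (fun q => ζ q * u q))) p
      = -(u p ^ k * pdx (fun q => ζ q * u q) p)
        + ((u p ^ k * pdx ζ p + pdt ζ p + pdx (pdx (pdx ζ)) p) * u p
          + 3 * pdx (pdx ζ) p * pdx u p + 3 * pdx ζ p * pdx (pdx u) p) := by
  have h0 := hu.hasDerivAt_pdx
  have h1 := hu.pdx.hasDerivAt_pdx
  have h2 := hu.pdx.pdx.hasDerivAt_pdx
  have z0 := hζ.hasDerivAt_pdx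
  have z1 := hζ.pdx.hasDerivAt_pdx
  have z2 := hζ.pdx.pdx.hasDerivAt_pdx
  have e1 := pdx_eq_of_hasDerivAt (f := fun q => ζ q * u q)
    (g := fun q => pdx ζ q * u q + ζ q * pdx u q) fun x t => (z0 x t).mul (h0 x t)
  have e2 := pdx_eq_of_hasDerivAt (f := fun q => pdx ζ q * u q + ζ q * pdx u q)
    (g := fun q => pdx (pdx ζ) q * u q + 2 * pdx ζ q * pdx u q + ζ q * pdx (pdx u) q)
    fun x t => (((z1 x t).mul (h0 x t)).add ((z0 x t).mul (h1 x t))).congr_deriv (by ring)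
  have e3 := pdx_eq_of_hasDerivAt
    (f := fun q => pdx (pdx ζ) q * u q + 2 * pdx ζ q * pdx u q + ζ q * pdx (pdx u) q)
    (g := fun q => pdx (pdx (pdx ζ)) q * u q + 3 * pdx (pdx ζ) q * pdx u q
      + 3 * pdx ζ q * pdx (pdx u) q + ζ q * pdx (pdx (pdx u)) q)
    fun x t => ((((z2 x t).mul (h0 x t)).add (((z1 x t).const_mul 2).mul (h1 x t))).add
      ((z0 x t).mul (h2 x t))).congr_deriv (by ring)
  have et := pdt_eq_of_hasDerivAt (f := fun q => ζ q * u q)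
    (g := fun q => pdt ζ q * u q + ζ q * pdt u q)
    fun x t => (hζ.hasDerivAt_pdt x t).mul (hu.hasDerivAt_pdt x t)
  rw [e1, e2, e3, et]
  linear_combination ζ p * hpde p

end Conjugation

section MovingCutoff

/-- A smooth cutoff, equal to `1` between the parabola `x = c + 1 + K * (t - t0) ^ 2`
and the line `x = N`. -/
noncomputable def movingCutoff (c K t0 N : ℝ) (p : ℝ × ℝ) : ℝ :=
  Real.smoothTransition (p.1 - K * (p.2 - t0) ^ 2 - c) - Real.smoothTransition (p.1 - N)

lemma contDiff_movingCutoff (c K t0 N : ℝ) :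
    ContDiff ℝ (⊤ : ℕ∞) (movingCutoff c K t0 N) := by
  unfold movingCutoff
  exact (Real.smoothTransition.contDiff.comp (by fun_prop)).sub
    (Real.smoothTransition.contDiff.comp (by fun_prop))

lemma exists_movingCutoff_derivs_bound {K t0 : ℝ} (hK : 0 ≤ K) (ht0 : t0 ∈ Set.Icc (0:ℝ) 1) :
    ∃ C, 0 ≤ C ∧ ∀ c N x, ∀ t ∈ Set.Icc (0:ℝ) 1,
      let ζ := movingCutoff c K t0 N
      (|pdx ζ (x, t)| ≤ C ∧ |pdx (pdx ζ) (x, t)| ≤ C ∧ |pdx (pdx (pdx ζ)) (x, t)| ≤ C ∧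
        |pdt ζ (x, t)| ≤ C) ∧
      ((x - K * (t - t0) ^ 2 ≤ c ∨ c + 1 ≤ x - K * (t - t0) ^ 2) → (x ≤ N ∨ N + 1 ≤ x) →
        pdx ζ (x, t) = 0 ∧ pdx (pdx ζ) (x, t) = 0 ∧ pdx (pdx (pdx ζ)) (x, t) = 0 ∧
          pdt ζ (x, t) = 0) := by
  obtain ⟨d0, hS⟩ := contDiff_infty_iff_deriv.1
    (Real.smoothTransition.contDiff (n := (⊤ : ℕ∞)))
  have ha := deriv_eq_zero_of_forall_le d0 (c := 0)
    fun x hx => Real.smoothTransition.zero_of_nonpos hx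
  have hb : ∀ x, 1 ≤ x → deriv Real.smoothTransition x = 0 := by
    intro x hx
    have := deriv_eq_zero_of_forall_ge (g := fun y => Real.smoothTransition y - 1) (c := 1)
      (d0.sub_const 1) (fun y hy => by simp [Real.smoothTransition.one_of_one_le hy]) x hx
    simpa using this
  obtain ⟨-, D1, D2, hz, C, hC⟩ := exists_derivs_bound_of_eq_zero_outside hS ha hb
  have D0 := fun x => (d0 x).hasDerivAt
  set S := Real.smoothTransition
  have hC0 : 0 ≤ C := (abs_nonneg _).trans (hC 0).1
  refine ⟨2 * C + 2 * K * C, by positivity, fun c N x t ht => ?_⟩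
  have key : ∀ F F' : ℝ → ℝ, (∀ x, HasDerivAt F (F' x) x) →
      pdx (fun p => F (p.1 - K * (p.2 - t0) ^ 2 - c) - F (p.1 - N))
        = fun p => F' (p.1 - K * (p.2 - t0) ^ 2 - c) - F' (p.1 - N) := by
    intro F F' h
    refine pdx_eq_of_hasDerivAt fun x t => ?_
    have i1 : HasDerivAt (fun y => y - K * (t - t0) ^ 2 - c) 1 x :=
      ((hasDerivAt_id x).sub_const _).sub_const _
    have i2 : HasDerivAt (fun y => y - N) 1 x := (hasDerivAt_id x).sub_const _
    exact (((h _).comp x i1).sub ((h _).comp x i2)).congr_deriv (by ring)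
  have e1 : pdx (movingCutoff c K t0 N) = _ := key S _ D0
  have e2 := key _ _ D1
  have e3 := key _ _ D2
  have et := pdt_eq_of_hasDerivAt (f := movingCutoff c K t0 N)
    (g := fun p => deriv S (p.1 - K * (p.2 - t0) ^ 2 - c) * (-(2 * K * (p.2 - t0))))
    (fun x t => by
      have i1 : HasDerivAt (fun s => x - K * (s - t0) ^ 2 - c) (-(2 * K * (t - t0))) t := by
        have := (((((hasDerivAt_id t).sub_const t0).pow 2).const_mul K).const_sub x).sub_const c
        refine this.congr_deriv ?_
        simp
        ring
      exact ((D0 _).comp t i1).sub_const (S (x - N)))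
  intro ζ
  simp only [ζ]
  rw [e1, e2, e3, et]
  have hts : |t - t0| ≤ 1 := by
    rw [abs_le]; constructor <;> linarith [ht.1, ht.2, ht0.1, ht0.2]
  have hKC : 0 ≤ 2 * K * C := by positivity
  refine ⟨⟨?_, ?_, ?_, ?_⟩, fun h1 h2 => ?_⟩
  · exact (abs_sub _ _).trans (by linarith [(hC (x - K * (t - t0) ^ 2 - c)).1, (hC (x - N)).1])
  · exact (abs_sub _ _).trans (by linarith [(hC (x - K * (t - t0) ^ 2 - c)).2.1, (hC (x - N)).2.1])
  · exact (abs_sub _ _).trans (by linarith [(hC (x - K * (t - t0) ^ 2 - c)).2.2, (hC (x - N)).2.2])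
  · have : |deriv S (x - K * (t - t0) ^ 2 - c) * (-(2 * K * (t - t0)))|
        ≤ C * (2 * K * 1) := by
      rw [abs_mul, abs_neg, abs_mul (2 * K), abs_of_nonneg (by positivity : 0 ≤ 2 * K)]
      gcongr
      exact (hC _).1
    simp only
    linarith
  · obtain ⟨a1, a2, a3⟩ := hz (x - K * (t - t0) ^ 2 - c)
      (h1.imp (fun h => by linarith) fun h => by linarith)
    obtain ⟨b1, b2, b3⟩ := hz (x - N) (h2.imp (fun h => by linarith) fun h => by linarith)
    simp [a1, a2, a3, b1, b2, b3]

end MovingCutoff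

section Localization

variable {u : ℝ × ℝ → ℝ} {k : ℕ}

/-- The terms produced by commuting the equation with the cutoff `ζ`. -/
noncomputable def cutoffSource (k : ℕ) (u ζ : ℝ × ℝ → ℝ) (p : ℝ × ℝ) : ℝ :=
  (u p ^ k * pdx ζ p + pdt ζ p + pdx (pdx (pdx ζ)) p) * u p
    + 3 * pdx (pdx ζ) p * pdx u p + 3 * pdx ζ p * pdx (pdx u) p

lemma RapidDecay.exists_pos {g : ℝ × ℝ → ℝ} (h : RapidDecay g) {β : ℝ} (hβ : 0 ≤ β) :
    ∃ C, 0 < C ∧ ∀ t ∈ Set.Icc (0:ℝ) 1, ∀ x, |g (x, t)| ≤ C * Real.exp (-(β * x)) := by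
  obtain ⟨C, hC⟩ := h β hβ
  refine ⟨|C| + 1, by positivity, fun t ht x => (hC t ht x).trans ?_⟩
  gcongr
  linarith [le_abs_self C]

lemma RapidDecay.exists_abs_le {g : ℝ × ℝ → ℝ} (h : RapidDecay g) :
    ∃ B, 0 < B ∧ ∀ t ∈ Set.Icc (0:ℝ) 1, ∀ x, |g (x, t)| ≤ B := by
  obtain ⟨B, hB0, hB⟩ := h.exists_pos le_rfl
  exact ⟨B, hB0, fun t ht x => by simpa using hB t ht x⟩

lemma RapidDecay.exists_pow_sq_le (h : RapidDecay u) (hk : 0 < k) (c : ℝ) :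
    ∃ C, 0 ≤ C ∧ ∀ t ∈ Set.Icc (0:ℝ) 1, ∀ x, (u (x, t) ^ k) ^ 2 ≤ C * Real.exp (c - x) := by
  obtain ⟨D, hD0, hD⟩ := h.exists_pos (β := 1 / 2) (by norm_num)
  obtain ⟨B, hB0, hB⟩ := h.exists_abs_le
  obtain ⟨j, rfl⟩ : ∃ j, k = j + 1 := ⟨k - 1, by omega⟩
  refine ⟨(B ^ j * D) ^ 2 * Real.exp (-c), by positivity, fun t ht x => ?_⟩
  have h1 : |u (x, t) ^ (j + 1)| ≤ B ^ j * (D * Real.exp (-(1 / 2 * x))) := by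
    rw [abs_pow, pow_succ]
    gcongr
    · exact hB t ht x
    · exact hD t ht x
  have h2 : Real.exp (-(1 / 2 * x)) ^ 2 = Real.exp (-c) * Real.exp (c - x) := by
    rw [← Real.exp_nat_mul, ← Real.exp_add]
    congr 1
    push_cast
    ring
  calc (u (x, t) ^ (j + 1)) ^ 2 = |u (x, t) ^ (j + 1)| ^ 2 := (sq_abs _).symm
    _ ≤ (B ^ j * (D * Real.exp (-(1 / 2 * x)))) ^ 2 := by gcongr
    _ = _ := by linear_combination (B ^ j * D) ^ 2 * h2

lemma exists_cutoffSource_bound {K t0 : ℝ} (hK : 0 ≤ K) (ht0 : t0 ∈ Set.Icc (0:ℝ) 1)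
    (hd : RapidDecay u) :
    ∃ C, 0 ≤ C ∧ ∀ c N x, ∀ t ∈ Set.Icc (0:ℝ) 1,
      (|cutoffSource k u (movingCutoff c K t0 N) (x, t)|
        ≤ C * (|u (x, t)| + |pdx u (x, t)| + |pdx (pdx u) (x, t)|)) ∧
      ((x - K * (t - t0) ^ 2 ≤ c ∨ c + 1 ≤ x - K * (t - t0) ^ 2) → (x ≤ N ∨ N + 1 ≤ x) →
        cutoffSource k u (movingCutoff c K t0 N) (x, t) = 0) := by
  obtain ⟨C, hC0, hC⟩ := exists_movingCutoff_derivs_bound hK ht0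
  obtain ⟨B, hB0, hB⟩ := hd.exists_abs_le
  refine ⟨B ^ k * C + 3 * C, by positivity, fun c N x t ht => ?_⟩
  obtain ⟨⟨b1, b2, b3, bt⟩, hz⟩ := hC c N x t ht
  refine ⟨?_, fun h1 h2 => ?_⟩
  · unfold cutoffSource
    have ha : |u (x, t) ^ k * pdx (movingCutoff c K t0 N) (x, t)| ≤ B ^ k * C := by
      rw [abs_mul, abs_pow]
      gcongr
      exact hB t ht x
    have hBC : 0 ≤ B ^ k * C := by positivity
    have e0 : |u (x, t) ^ k * pdx (movingCutoff c K t0 N) (x, t) + pdt (movingCutoff c K t0 N) (x, t)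
        + pdx (pdx (pdx (movingCutoff c K t0 N))) (x, t)| ≤ B ^ k * C + 3 * C :=
      (abs_add_three _ _ _).trans (by linarith)
    have e1 : |3 * pdx (pdx (movingCutoff c K t0 N)) (x, t)| ≤ B ^ k * C + 3 * C := by
      rw [abs_mul, abs_of_pos (by norm_num : (0:ℝ) < 3)]; linarith
    have e2 : |3 * pdx (movingCutoff c K t0 N) (x, t)| ≤ B ^ k * C + 3 * C := by
      rw [abs_mul, abs_of_pos (by norm_num : (0:ℝ) < 3)]; linarith
    refine (abs_add_three _ _ _).trans ?_
    have f0 := mul_le_mul_of_nonneg_right e0 (abs_nonneg (u (x, t)))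
    have f1 := mul_le_mul_of_nonneg_right e1 (abs_nonneg (pdx u (x, t)))
    have f2 := mul_le_mul_of_nonneg_right e2 (abs_nonneg (pdx (pdx u) (x, t)))
    rw [← abs_mul] at f0 f1 f2
    linarith
  · obtain ⟨a1, a2, a3, at'⟩ := hz h1 h2
    simp [cutoffSource, a1, a2, a3, at']

lemma exists_weighted_cutoffSource_bound {K t0 : ℝ} (hK : 0 ≤ K) (ht0 : t0 ∈ Set.Icc (0:ℝ) 1)
    (c : ℝ) (hd0 : RapidDecay u) (hd1 : RapidDecay (pdx u)) (hd2 : RapidDecay (pdx (pdx u))) :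
    ∃ C, 0 ≤ C ∧ ∀ lam, 1 ≤ lam → ∃ N0, ∀ N, N0 ≤ N → ∀ x, c ≤ x → ∀ t ∈ Set.Icc (0:ℝ) 1,
      (Real.exp (carlemanPhase c lam (4 * lam * K) t0 (x, t))
        * cutoffSource k u (movingCutoff c K t0 N) (x, t)) ^ 2
      ≤ C * Real.exp (2 * lam * (2 * c + 3)) * Real.exp (c - x) := by
  obtain ⟨A, hA0, hA⟩ := exists_cutoffSource_bound (k := k) hK ht0 hd0
  obtain ⟨B0, hB0, hB0'⟩ := hd0.exists_abs_le
  obtain ⟨B1, hB1, hB1'⟩ := hd1.exists_abs_le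
  obtain ⟨B2, hB2, hB2'⟩ := hd2.exists_abs_le
  refine ⟨(A * (B0 + B1 + B2)) ^ 2 * Real.exp (K + 1) + 1, by positivity, fun lam hlam => ?_⟩
  have hβ : 0 ≤ 2 * lam + 1 := by linarith
  obtain ⟨D0, hD0, hD0'⟩ := hd0.exists_pos hβ
  obtain ⟨D1, hD1, hD1'⟩ := hd1.exists_pos hβ
  obtain ⟨D2, hD2, hD2'⟩ := hd2.exists_pos hβ
  set D := A * (D0 + D1 + D2) with hD
  set δ := Real.exp (2 * lam * (2 * c + 3)) * Real.exp (c) with hδ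
  have hδ0 : 0 < δ := by positivity
  refine ⟨D ^ 2 * Real.exp (2 * lam) / δ, fun N hN x hx t ht => ?_⟩
  have hts : (t - t0) ^ 2 ≤ 1 := by
    rw [sq_le_one_iff_abs_le_one, abs_le]
    constructor <;> linarith [ht.1, ht.2, ht0.1, ht0.2]
  have hKt : K * (t - t0) ^ 2 ≤ K := by nlinarith
  have hKt0 : 0 ≤ K * (t - t0) ^ 2 := by positivity
  have hE1 : Real.exp (c - x) ≤ 1 := Real.exp_le_one_iff.2 (by linarith)
  have hphase : carlemanPhase c lam (4 * lam * K) t0 (x, t)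
      ≤ lam * (2 * (x - K * (t - t0) ^ 2) + 1) := by
    have : lam * Real.exp (c - x) ≤ lam * 1 := by gcongr
    simp only [carlemanPhase]
    linarith
  obtain ⟨hb, hz⟩ := hA c N x t ht
  set e := cutoffSource k u (movingCutoff c K t0 N) (x, t)
  set ψ := carlemanPhase c lam (4 * lam * K) t0 (x, t)
  have hψ2 : Real.exp ψ ^ 2 = Real.exp (2 * ψ) := by
    rw [← Real.exp_nat_mul]; norm_num
  have hW := Real.exp_pos (2 * lam * (2 * c + 3))
  have hEp := Real.exp_pos (c - x)
  rw [mul_pow, hψ2]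
  by_cases h1 : x ≤ N ∨ N + 1 ≤ x
  · by_cases h2 : x - K * (t - t0) ^ 2 ≤ c ∨ c + 1 ≤ x - K * (t - t0) ^ 2
    · rw [hz h2 h1]
      simp only [ne_eq, OfNat.ofNat_ne_zero, not_false_eq_true, zero_pow, mul_zero]
      positivity
    · push Not at h2
      have he : |e| ≤ A * (B0 + B1 + B2) := hb.trans (by
        gcongr
        · exact hB0' t ht x
        · exact hB1' t ht x
        · exact hB2' t ht x)
      have he2 : e ^ 2 ≤ (A * (B0 + B1 + B2)) ^ 2 := by
        rw [← sq_abs e]; gcongr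
      have hexp : Real.exp (2 * ψ) ≤ Real.exp (2 * lam * (2 * c + 3)) := by
        apply Real.exp_le_exp.2
        have : lam * (2 * (x - K * (t - t0) ^ 2) + 1) ≤ lam * (2 * (c + 1) + 1) := by
          gcongr; exact h2.2.le
        linarith
      have hone : 1 ≤ Real.exp (K + 1) * Real.exp (c - x) := by
        rw [← Real.exp_add]
        exact Real.one_le_exp (by linarith)
      calc Real.exp (2 * ψ) * e ^ 2
          ≤ Real.exp (2 * lam * (2 * c + 3)) * (A * (B0 + B1 + B2)) ^ 2 := by gcongr
        _ ≤ Real.exp (2 * lam * (2 * c + 3)) * (A * (B0 + B1 + B2)) ^ 2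
            * (Real.exp (K + 1) * Real.exp (c - x)) := le_mul_of_one_le_right (by positivity) hone
        _ ≤ _ := by nlinarith [mul_pos hW hEp]
  · push Not at h1
    have he : |e| ≤ D * Real.exp (-((2 * lam + 1) * x)) := hb.trans (by
      have := hD0' t ht x
      have := hD1' t ht x
      have := hD2' t ht x
      rw [hD, mul_assoc]
      gcongr
      linarith)
    have he2 : e ^ 2 ≤ D ^ 2 * Real.exp (-(2 * (2 * lam + 1) * x)) := by
      rw [← sq_abs e]
      refine (pow_le_pow_left₀ (abs_nonneg e) he 2).trans (le_of_eq ?_)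
      rw [mul_pow, ← Real.exp_nat_mul]
      congr 2
      push_cast
      ring
    have hexp : Real.exp (2 * ψ) ≤ Real.exp (4 * lam * x + 2 * lam) := by
      apply Real.exp_le_exp.2
      have : 0 ≤ lam * (K * (t - t0) ^ 2) := by positivity
      linarith
    have hfin : D ^ 2 * Real.exp (2 * lam) ≤ δ * Real.exp x := by
      have : D ^ 2 * Real.exp (2 * lam) ≤ δ * N := by
        rw [div_le_iff₀ hδ0] at hN; linarith
      have hN' : N ≤ Real.exp x := by linarith [Real.add_one_le_exp x]
      exact this.trans (by gcongr)
    calc Real.exp (2 * ψ) * e ^ 2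
        ≤ Real.exp (4 * lam * x + 2 * lam) * (D ^ 2 * Real.exp (-(2 * (2 * lam + 1) * x))) := by
          gcongr
      _ = D ^ 2 * Real.exp (2 * lam) * Real.exp (-(2 * x)) := by
          rw [show Real.exp (4 * lam * x + 2 * lam) * (D ^ 2 * Real.exp (-(2 * (2 * lam + 1) * x)))
            = D ^ 2 * (Real.exp (4 * lam * x + 2 * lam) * Real.exp (-(2 * (2 * lam + 1) * x)))
            by ring, ← Real.exp_add, mul_assoc (D ^ 2), ← Real.exp_add]
          congr 2
          ring
      _ ≤ δ * Real.exp x * Real.exp (-(2 * x)) := by gcongr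
      _ = 1 * Real.exp (2 * lam * (2 * c + 3)) * Real.exp (c - x) := by
          rw [hδ, one_mul, mul_assoc, mul_assoc, ← Real.exp_add, ← Real.exp_add]
          congr 2
          ring
      _ ≤ _ := by
          gcongr
          have : 0 ≤ (A * (B0 + B1 + B2)) ^ 2 * Real.exp (K + 1) := by positivity
          linarith

end Localization

section UniqueContinuation

variable {u : ℝ × ℝ → ℝ} {k : ℕ}

lemma integral_exp_const_sub_rectangle_le {c X : ℝ} (hcX : c ≤ X) :
    ∫ p in Set.Icc c X ×ˢ Set.Icc (0:ℝ) 1, Real.exp (c - p.1) ≤ 1 := by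
  have hexp := (by fun_prop : Continuous fun p : ℝ × ℝ => Real.exp (c - p.1)).integrableOn_rectangle
    (a := c) (b := X) (c := 0) (d := 1)
  rw [Measure.volume_eq_prod] at hexp ⊢
  rw [setIntegral_prod _ hexp]
  simp only [integral_const, MeasurableSet.univ, measureReal_restrict_apply, Set.univ_inter,
    Real.volume_real_Icc, sub_zero, max_eq_left zero_le_one, smul_eq_mul, one_mul]
  rw [integral_Icc_eq_integral_Ioc, ← intervalIntegral.integral_of_le hcX]
  rw [intervalIntegral.integral_eq_sub_of_hasDerivAt (f := fun x => -Real.exp (c - x))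
    (fun x _ => (hasDerivAt_exp_const_sub c x).neg.congr_deriv (neg_neg _))
    (Continuous.intervalIntegrable (by fun_prop) _ _)]
  simp only [sub_self, Real.exp_zero]
  linarith [Real.exp_pos (c - X)]

/-- The integrand of the Carleman inequality is controlled by the source term. -/
lemma carleman_integrand_le {E a m f0 f1 e s lam Ca Ch W Cs kap : ℝ} (hE : 0 ≤ E)
    (hm0 : 0 ≤ m) (hm : m ≤ 2 * lam) (ha : a ^ 2 ≤ Ca * E) (hCa : 0 ≤ Ca)
    (hkap : kap * f0 ^ 2 ≤ 4 * lam * (Ch * E * f0 ^ 2)) (he : e ^ 2 ≤ Cs * W * E)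
    (h1 : Ca ≤ 3 * lam ^ 3) (h2 : 16 * Ca * lam ^ 2 + 4 * lam * Ch ≤ 2 * lam ^ 5)
    (hs : s = -(a * (f1 - m * f0)) + e) :
    s ^ 2 - (E * (12 * lam ^ 3 * f1 ^ 2 + 3 * lam ^ 5 * f0 ^ 2) - kap * f0 ^ 2)
      ≤ 2 * Cs * W * E - lam ^ 5 * (E * f0 ^ 2) := by
  have i1 : s ^ 2 ≤ 2 * (a ^ 2 * (f1 - m * f0) ^ 2) + 2 * e ^ 2 := by
    rw [hs]; nlinarith [sq_nonneg (a * (f1 - m * f0) + e)]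
  have i2 : (f1 - m * f0) ^ 2 ≤ 2 * f1 ^ 2 + 8 * lam ^ 2 * f0 ^ 2 := by
    have : m ^ 2 * f0 ^ 2 ≤ (2 * lam) ^ 2 * f0 ^ 2 := by gcongr
    nlinarith [sq_nonneg (f1 + m * f0)]
  have i3 : a ^ 2 * (f1 - m * f0) ^ 2 ≤ Ca * E * (2 * f1 ^ 2 + 8 * lam ^ 2 * f0 ^ 2) := by
    gcongr
  have i4 : Ca * (E * f1 ^ 2) ≤ 3 * lam ^ 3 * (E * f1 ^ 2) := by gcongr
  have i5 : (16 * Ca * lam ^ 2 + 4 * lam * Ch) * (E * f0 ^ 2) ≤ 2 * lam ^ 5 * (E * f0 ^ 2) := by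
    gcongr
  linarith

lemma eq_zero_right_of_parabola (hk : 0 < k) (hu : ContDiff ℝ (⊤ : ℕ∞) u)
    (hpde : ∀ p : ℝ × ℝ, pdt u p + pdx (pdx (pdx u)) p + (u p) ^ k * pdx u p = 0)
    (hd0 : RapidDecay u) (hd1 : RapidDecay (pdx u)) (hd2 : RapidDecay (pdx (pdx u)))
    {K t0 c : ℝ} (hK : 0 ≤ K) (ht0 : t0 ∈ Set.Ioo (0:ℝ) 1)
    (hu0 : ∀ x, c < x - K * t0 ^ 2 → u (x, 0) = 0)
    (hu1 : ∀ x, c < x - K * (1 - t0) ^ 2 → u (x, 1) = 0)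
    (hKu : ∃ C, ∀ t ∈ Set.Icc (0:ℝ) 1, ∀ x, c ≤ x →
      K * u (x, t) ^ 2 ≤ C * Real.exp (c - x) * u (x, t) ^ 2)
    {y : ℝ} (hy : c + 2 < y) : u (y, t0) = 0 := by
  by_contra hne
  have ht0' := Set.Ioo_subset_Icc_self ht0
  obtain ⟨Ca, hCa0, hCa⟩ := hd0.exists_pow_sq_le hk c
  obtain ⟨Ch, hCh⟩ := hKu
  obtain ⟨Cs, hCs0, hCs⟩ := exists_weighted_cutoffSource_bound (k := k) hK ht0' c hd0 hd1 hd2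
  have hucont := hu.continuous
  obtain ⟨r, hr0, hr⟩ : ∃ r > 0, ∀ p ∈ Metric.closedBall (y, t0) r,
      u (y, t0) ^ 2 / 2 < u p ^ 2 ∧ c + 2 < p.1 - K * (p.2 - t0) ^ 2 ∧ p.2 ∈ Set.Ioo (0:ℝ) 1 := by
    have hη : u (y, t0) ^ 2 / 2 < u (y, t0) ^ 2 := half_lt_self (by positivity)
    have o1 : ∀ᶠ p in nhds (y, t0), u (y, t0) ^ 2 / 2 < u p ^ 2 :=
      (by fun_prop : Continuous fun p => u p ^ 2).continuousAt.eventually_const_lt hη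
    have o2 : ∀ᶠ p : ℝ × ℝ in nhds (y, t0), c + 2 < p.1 - K * (p.2 - t0) ^ 2 :=
      (by fun_prop : Continuous fun p : ℝ × ℝ =>
        p.1 - K * (p.2 - t0) ^ 2).continuousAt.eventually_const_lt (by simpa using hy)
    have o3 : ∀ᶠ p : ℝ × ℝ in nhds (y, t0), p.2 ∈ Set.Ioo (0:ℝ) 1 :=
      continuous_snd.continuousAt.eventually (isOpen_Ioo.mem_nhds ht0)
    exact Metric.nhds_basis_closedBall.eventually_iff.1 (o1.and (o2.and o3))
  set η := u (y, t0) ^ 2 / 2 with hη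
  have hη0 : 0 < η := by positivity
  set Q := Metric.closedBall (y, t0) r with hQ
  have hQvol : 0 < volume.real Q := by
    rw [measureReal_def]
    exact ENNReal.toReal_pos (Metric.measure_closedBall_pos volume _ hr0).ne'
      measure_closedBall_lt_top.ne
  have hQfst : ∀ p ∈ Q, p.1 ≤ y + r := fun p hp => by
    have h := (le_max_left _ _).trans (Metric.mem_closedBall.1 hp)
    rw [Real.dist_eq, abs_le] at h
    simp only at h
    linarith [h.2]
  set m := Real.exp (c - (y + r)) * η * volume.real Q with hm
  have hm0 : 0 < m := by positivity
  obtain ⟨lam, hlam⟩ : ∃ lam : ℝ, 1 + Ca + 16 * Ca + 4 * |Ch| + 2 * Cs / m ≤ lam := ⟨_, le_rfl⟩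
  have hCm : 0 ≤ 2 * Cs / m := by positivity
  have hlam1 : 1 ≤ lam := by linarith [abs_nonneg Ch]
  have hCalam : Ca ≤ lam := by linarith [abs_nonneg Ch]
  have hCslam : 2 * Cs < lam * m := by
    rw [← div_lt_iff₀ hm0]; linarith [abs_nonneg Ch]
  have hlam3 : Ca ≤ 3 * lam ^ 3 := by
    nlinarith [one_le_pow₀ hlam1 (n := 3), pow_le_pow_right₀ hlam1 (show 1 ≤ 3 by norm_num)]
  have hlam5 : 16 * Ca * lam ^ 2 + 4 * lam * Ch ≤ 2 * lam ^ 5 := by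
    have j1 : 16 * Ca * lam ^ 2 ≤ lam * lam ^ 2 := by gcongr; linarith [abs_nonneg Ch]
    have j2 : 4 * lam * Ch ≤ lam * lam := by nlinarith [le_abs_self Ch]
    have j3 := pow_le_pow_right₀ hlam1 (show 3 ≤ 5 by norm_num)
    have j4 := pow_le_pow_right₀ hlam1 (show 2 ≤ 5 by norm_num)
    linarith
  obtain ⟨N0, hN0⟩ := hCs lam hlam1
  obtain ⟨N, hN, hNy, hNc⟩ : ∃ N, N0 ≤ N ∧ y + r ≤ N ∧ c + 1 + K ≤ N :=
    ⟨max N0 (max (y + r) (c + 1 + K)), by simp, by simp, by simp⟩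
  replace hN0 := hN0 N hN
  set ζ := movingCutoff c K t0 N with hζ
  set kap := 4 * lam * K with hkap
  set P := carlemanPhase c lam kap t0 with hP
  set W := Real.exp (2 * lam * (2 * c + 3)) with hW
  have hζs : ContDiff ℝ (⊤ : ℕ∞) ζ := contDiff_movingCutoff c K t0 N
  have hvs : ContDiff ℝ (⊤ : ℕ∞) (fun q => ζ q * u q) := hζs.mul hu
  set f := fun q => Real.exp (P q) * (ζ q * u q) with hf
  have hfs : ContDiff ℝ (⊤ : ℕ∞) f := (contDiff_carlemanPhase c lam kap t0).exp.mul hvs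
  have hfcont := hfs.continuous
  have hKt : ∀ t ∈ Set.Icc (0:ℝ) 1, 0 ≤ K * (t - t0) ^ 2 ∧ K * (t - t0) ^ 2 ≤ K := by
    intro t ht
    have : (t - t0) ^ 2 ≤ 1 := by
      rw [sq_le_one_iff_abs_le_one, abs_le]
      constructor <;> linarith [ht.1, ht.2, ht0.1, ht0.2]
    exact ⟨by positivity, by nlinarith⟩
  have hζl : ∀ x t, x - K * (t - t0) ^ 2 ≤ c → x ≤ N → ζ (x, t) = 0 := by
    intro x t h1 h2
    simp only [hζ, movingCutoff]
    rw [Real.smoothTransition.zero_of_nonpos (by linarith),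
      Real.smoothTransition.zero_of_nonpos (by linarith), sub_zero]
  have hζr : ∀ t ∈ Set.Icc (0:ℝ) 1, ∀ x, N + 1 ≤ x → ζ (x, t) = 0 := by
    intro t ht x h1
    have := hKt t ht
    simp only [hζ, movingCutoff]
    rw [Real.smoothTransition.one_of_one_le (by linarith),
      Real.smoothTransition.one_of_one_le (by linarith), sub_self]
  have hζ1 : ∀ p : ℝ × ℝ, c + 1 ≤ p.1 - K * (p.2 - t0) ^ 2 → p.1 ≤ N → ζ p = 1 := by
    intro p h1 h2
    simp only [hζ, movingCutoff]
    rw [Real.smoothTransition.one_of_one_le (by linarith),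
      Real.smoothTransition.zero_of_nonpos (by linarith), sub_zero]
  have hcN : c ≤ N + 1 := by linarith
  have hend : ∀ t ∈ Set.Icc (0:ℝ) 1, (∀ x, c < x - K * (t - t0) ^ 2 → u (x, t) = 0) →
      ∀ x, f (x, t) = 0 := by
    intro t ht h x
    rcases le_or_gt (x - K * (t - t0) ^ 2) c with hx | hx
    · simp [hf, hζl x t hx (by linarith [(hKt t ht).2])]
    · simp [hf, h x hx]
  have hcarl := carleman_inequality hfs kap t0 hcN hlam1
    (fun t ht x hx => by
      simp [hf, hζl x t (by linarith [(hKt t ht).1]) (by linarith)])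
    (fun t ht x hx => by simp [hf, hζr t ht x hx])
    (hend 0 (by simp) (by simpa using hu0)) (hend 1 (by simp) hu1)
  set R := Set.Icc c (N + 1) ×ˢ Set.Icc (0:ℝ) 1 with hR
  have hRm : MeasurableSet R := measurableSet_Icc.prod measurableSet_Icc
  have hpt : ∀ p ∈ R, conjAiry c lam kap t0 f p ^ 2
      - (Real.exp (c - p.1) * (12 * lam ^ 3 * pdx f p ^ 2 + 3 * lam ^ 5 * f p ^ 2) - kap * f p ^ 2)
      ≤ 2 * Cs * W * Real.exp (c - p.1) - lam ^ 5 * (Real.exp (c - p.1) * f p ^ 2) := by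
    rintro ⟨x, t⟩ ⟨hx, ht⟩
    simp only at hx ht
    have hE1 : Real.exp (c - x) ≤ 1 := Real.exp_le_one_iff.2 (by linarith [hx.1])
    have hE0 := Real.exp_pos (c - x)
    obtain ⟨q1, q2⟩ := conjAiry_exp_mul hvs c lam kap t0 (x, t)
    rw [airy_mul_of_pde hu hpde hζs] at q2
    refine carleman_integrand_le (a := u (x, t) ^ k) (m := lam * (2 - Real.exp (c - x)))
      (e := Real.exp (P (x, t)) * cutoffSource k u ζ (x, t)) (Ch := Ch) hE0.le ?_ ?_
      (hCa t ht x) hCa0 ?_ (hN0 x hx.1 t ht) hlam3 hlam5 ?_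
    · have : 0 ≤ 2 - Real.exp (c - x) := by linarith
      positivity
    · nlinarith
    · have := mul_le_mul_of_nonneg_left (hCh t ht x hx.1)
        (by positivity : 0 ≤ 4 * lam * (Real.exp (P (x, t)) * ζ (x, t)) ^ 2)
      simp only [hf, hkap]
      linarith
    · simp only [hf, hP]
      rw [q1, q2, cutoffSource]
      ring
  have cL := continuous_conjAiry hfs c lam kap t0
  have c1 := hfs.pdx.continuous
  have iE : IntegrableOn (fun p : ℝ × ℝ => Real.exp (c - p.1)) R :=
    Continuous.integrableOn_rectangle (by fun_prop)
  have iEf : IntegrableOn (fun p : ℝ × ℝ => Real.exp (c - p.1) * f p ^ 2) R :=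
    Continuous.integrableOn_rectangle (by fun_prop)
  have hle := hcarl.trans (setIntegral_mono_on
    (Continuous.integrableOn_rectangle (by fun_prop))
    ((iE.const_mul (2 * Cs * W)).sub (iEf.const_mul (lam ^ 5))) hRm hpt)
  simp only [Pi.sub_apply] at hle
  rw [integral_sub (iE.const_mul _) (iEf.const_mul _), integral_const_mul,
    integral_const_mul] at hle
  have hQR : Q ⊆ R := fun p hp => by
    obtain ⟨-, h2, h3⟩ := hr p hp
    have h3' := Set.Ioo_subset_Icc_self h3
    exact ⟨⟨by linarith [(hKt _ h3').1], by linarith [hQfst p hp]⟩, h3'⟩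
  have hQm : MeasurableSet Q := Metric.isClosed_closedBall.measurableSet
  have hlow : W * m ≤ ∫ p in R, Real.exp (c - p.1) * f p ^ 2 := by
    calc W * m = ∫ p in Q, Real.exp (c - (y + r)) * (W * η) := by
          rw [setIntegral_const, smul_eq_mul, hm]; ring
      _ ≤ ∫ p in Q, Real.exp (c - p.1) * f p ^ 2 := by
          refine setIntegral_mono_on (integrableOn_const measure_closedBall_lt_top.ne)
            (iEf.mono_set hQR) hQm fun p hp => ?_
          obtain ⟨h1, h2, h3⟩ := hr p hp
          have g1 : Real.exp (c - (y + r)) ≤ Real.exp (c - p.1) :=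
            Real.exp_le_exp.2 (by linarith [hQfst p hp])
          have g2 : W ≤ Real.exp (P p) ^ 2 := by
            rw [← Real.exp_nat_mul, hW]
            apply Real.exp_le_exp.2
            have : lam * (c + 2) ≤ lam * (p.1 - K * (p.2 - t0) ^ 2) := by gcongr
            have : 0 ≤ lam * Real.exp (c - p.1) := by positivity
            simp only [hP, carlemanPhase, hkap]
            push_cast
            linarith
          have g3 : f p ^ 2 = Real.exp (P p) ^ 2 * u p ^ 2 := by
            simp only [hf]
            rw [hζ1 p (by linarith) ((hQfst p hp).trans hNy)]
            ring
          rw [g3]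
          gcongr
      _ ≤ ∫ p in R, Real.exp (c - p.1) * f p ^ 2 := by
          refine setIntegral_mono_set iEf (ae_of_all _ fun p => ?_) hQR.eventuallyLE
          simp only [Pi.zero_apply]
          positivity
  have hup : ∫ p in R, Real.exp (c - p.1) ≤ 1 := integral_exp_const_sub_rectangle_le hcN
  have hWpos : 0 < W := Real.exp_pos _
  have k1 : 2 * Cs * W * ∫ p in R, Real.exp (c - p.1) ≤ 2 * Cs * W * 1 := by gcongr
  have k2 : lam ^ 5 * (W * m) ≤ lam ^ 5 * ∫ p in R, Real.exp (c - p.1) * f p ^ 2 := by gcongr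
  have k3 : lam * (W * m) ≤ lam ^ 5 * (W * m) := by
    gcongr
    exact le_self_pow₀ hlam1 (by norm_num)
  have k4 : 2 * Cs * W < lam * m * W := by gcongr
  linarith

end UniqueContinuation

theorem stmt19 (k : ℕ) (hk : 0 < k) (b : ℝ) (u : ℝ × ℝ → ℝ)
    (hsmooth : ContDiff ℝ (⊤ : ℕ∞) u)
    (hH4 : ∃ A : ℝ, ∀ t ∈ Set.Icc (0:ℝ) 1, ∀ n ≤ 4,
      eLpNorm (fun x => iteratedDeriv n (fun y => u (y, t)) x) 2 volume ≤ ENNReal.ofReal A)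
    (hpde : ∀ p : ℝ × ℝ, pdt u p + pdx (pdx (pdx u)) p + (u p) ^ k * pdx u p = 0)
    (hsupp0 : ∀ x : ℝ, b ≤ x → u (x, 0) = 0)
    (hsupp1 : ∀ x : ℝ, b ≤ x → u (x, 1) = 0) :
    ∀ x : ℝ, ∀ t ∈ Set.Icc (0:ℝ) 1, u (x, t) = 0 := by
  obtain ⟨M, hM⟩ := exists_L2_and_sup_bounds hsmooth hH4
  have hd0 : RapidDecay u := rapidDecay_of_support hsmooth hpde hsupp0
    (fun t ht => (hM t ht).2 0 (by norm_num)) (fun t ht => (hM t ht).2 1 (by norm_num))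
    (fun t ht => (hM t ht).1 0 (by norm_num)) (fun t ht => (hM t ht).1 1 (by norm_num))
  have hd1 : RapidDecay (pdx u) := hd0.pdx hsmooth fun t ht => (hM t ht).2 2 (by norm_num)
  have hd2 : RapidDecay (pdx (pdx u)) :=
    hd1.pdx hsmooth.pdx fun t ht => (hM t ht).2 3 (by norm_num)
  have hright : ∀ t ∈ Set.Icc (0:ℝ) 1, ∀ x, b + 2 < x → u (x, t) = 0 := by
    intro t ht x hx
    rcases ht.1.eq_or_lt with rfl | h0
    · exact hsupp0 x (by linarith)
    rcases ht.2.eq_or_lt with rfl | h1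
    · exact hsupp1 x (by linarith)
    exact eq_zero_right_of_parabola hk hsmooth hpde hd0 hd1 hd2 le_rfl ⟨h0, h1⟩
      (fun y hy => hsupp0 y (by linarith)) (fun y hy => hsupp1 y (by linarith))
      ⟨0, fun _ _ _ _ => by simp⟩ hx
  have hinterior : ∀ t ∈ Set.Ioo (0:ℝ) 1, ∀ x, u (x, t) = 0 := by
    intro t ht x
    have hs0 : 0 < t ^ 2 := by have := ht.1; positivity
    have hs1 : 0 < (1 - t) ^ 2 := by have := sub_pos.2 ht.2; positivity
    obtain ⟨K, hK, hK0, hK1⟩ :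
        ∃ K, 0 ≤ K ∧ b - (x - 3) ≤ K * t ^ 2 ∧ b - (x - 3) ≤ K * (1 - t) ^ 2 := by
      refine ⟨max 0 (max ((b - (x - 3)) / t ^ 2) ((b - (x - 3)) / (1 - t) ^ 2)), by simp, ?_, ?_⟩
      · rw [← div_le_iff₀ hs0]; simp
      · rw [← div_le_iff₀ hs1]; simp
    refine eq_zero_right_of_parabola (c := x - 3) hk hsmooth hpde hd0 hd1 hd2 hK ht
      (fun y hy => hsupp0 y (by linarith)) (fun y hy => hsupp1 y (by linarith))
      ⟨K * Real.exp (b + 2 - (x - 3)), fun s hs y hy => ?_⟩ (by linarith)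
    rcases lt_or_ge (b + 2) y with hby | hby
    · simp [hright s hs y hby]
    · gcongr
      rw [mul_assoc, ← Real.exp_add]
      exact le_mul_of_one_le_right hK (Real.one_le_exp (by linarith))
  intro x t ht
  have hcl : Set.Icc (0:ℝ) 1 ⊆ {s | u (x, s) = 0} := by
    rw [← closure_Ioo zero_ne_one]
    have hc := hsmooth.continuous
    exact closure_minimal (fun s hs => hinterior s hs x)
      (isClosed_eq (by fun_prop) continuous_const)
  exact hcl ht
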